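/- arXiv:2501.08158 — 3 statements merged into one kernel-verified Lean document; each statement's English description precedes it below -/
import Mathlib

section
/- Let p be an odd prime, k ≥ 2 an integer, and s a finite multiset of complex p^k-th roots of unity. Then p divides the field extension degree [Q(ζ_{p^k}) : Q(|s|)] if and only if |s^{(p^k)}| = 0, where Q(|s|) denotes the subfield of Q(ζ_{p^k}) generated by |s|. In particular, if the number of entries of s of order exactly p^k (with multiplicity), or the number of distinct such entries, is not divisible by p, then p does not divide [Q(ζ_{p^k}) : Q(|s|)]. -/
open CategoryTheory

/-- `Qcyc N` is the `N`-th cyclotomic field `ℚ(ζ_N)`, realised as the subfield of `ℂ`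
generated by all `N`-th roots of unity. -/
noncomputable def Qcyc (N : ℕ) : IntermediateField ℚ ℂ :=
  IntermediateField.adjoin ℚ {z : ℂ | z ^ N = 1}

/-- `Qadj c` is the subfield `ℚ(c)` of `ℂ` generated by a complex number `c`. -/
noncomputable def Qadj (c : ℂ) : IntermediateField ℚ ℂ :=
  IntermediateField.adjoin ℚ {c}

/-- `f` is the conductor of the complex number `c`: the least positive integer `N`
with `c ∈ ℚ(ζ_N)`. -/
def IsConductorOf (c : ℂ) (f : ℕ) : Prop :=
  IsLeast {N : ℕ | 0 < N ∧ c ∈ Qcyc N} f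

/-- `f` is the conductor of the character `χ`: the least positive integer `N` such that all
values of `χ` lie in `ℚ(ζ_N)`. -/
def IsCharConductor {G : Type*} [Monoid G] (χ : G → ℂ) (f : ℕ) : Prop :=
  IsLeast {N : ℕ | 0 < N ∧ ∀ g, χ g ∈ Qcyc N} f

/-- Property 1.3 of Navarro–Tiep for `(G, χ, p)`: writing the conductor of `χ` as
`f = p ^ a * m` with `p ∤ m` (so that `p ^ a = p ^ (f.factorization p)` is the `p`-part of `f`),
there is a `p`-element `g ∈ G` such that `p ∤ [ℚ(ζ_{p^a}) : ℚ(χ(g))]`. -/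
def Property13 {G : Type*} [Group G] (χ : G → ℂ) (p : ℕ) : Prop :=
  ∀ f : ℕ, IsCharConductor χ f →
    ∃ g : G, (∃ j : ℕ, orderOf g = p ^ j) ∧
      ¬ p ∣ (Qadj (χ g)).relfinrank (Qcyc (p ^ f.factorization p))


theorem aux_mod (p k a : ℕ) (hp : p.Prime) (hodd : Odd p) (hk : 2 ≤ k)
    (h : a ^ p ≡ 1 [MOD p ^ k]) : ∃ c, a = 1 + p ^ (k-1) * c := by
  have := Fact.mk hp
  have hp1 : a ≡ 1 [MOD p] := by
    have h1 : a ^ p ≡ 1 [MOD p] := h.of_dvd (dvd_pow_self p (by omega))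
    rw [← ZMod.natCast_eq_natCast_iff] at h1 ⊢
    simpa [ZMod.pow_card] using h1
  have ha : 1 ≤ a := by
    rcases Nat.eq_zero_or_pos a with h0 | h0
    · subst h0
      exfalso
      have := (Nat.modEq_iff_dvd' (Nat.zero_le 1)).1 hp1
      exact hp.one_lt.ne' (Nat.dvd_one.1 this)
    · exact h0
  have hpa : p ∣ a - 1 := (Nat.modEq_iff_dvd' ha).1 hp1.symm
  have hpk : p ^ k ∣ a ^ p - 1 := (Nat.modEq_iff_dvd' (Nat.one_le_pow _ _ ha)).1 h.symm
  have hna : ¬ p ∣ a := fun hd => by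
    have := (Nat.dvd_sub hd hpa)
    rw [Nat.sub_sub_self ha] at this
    exact hp.one_lt.ne' (Nat.dvd_one.1 this)
  have := Nat.emultiplicity_pow_sub_pow hp hodd (x := a) (y := 1) hpa hna p
  rw [one_pow, hp.emultiplicity_self] at this
  have h2 : (k : ℕ∞) ≤ emultiplicity p (a ^ p - 1) := le_emultiplicity_of_pow_dvd hpk
  rw [this] at h2
  have h3 : ((k - 1 : ℕ) : ℕ∞) ≤ emultiplicity p (a - 1) := by
    have : (k : ℕ∞) = ((k-1 : ℕ) : ℕ∞) + 1 := by
      norm_cast; omega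
    rw [this] at h2
    exact (ENat.add_le_add_iff_right (by simp)).1 h2
  obtain ⟨c, hc⟩ := pow_dvd_of_le_emultiplicity h3
  exact ⟨c, by omega⟩

theorem aux_ord {L : Type*} [Field L] (p k : ℕ) (hp : p.Prime) (hk : 2 ≤ k) (z : L)
    (hz : z ^ p ^ k = 1) (h : orderOf z ≠ p ^ k) : z ^ p ^ (k-1) = 1 := by
  obtain ⟨j, hj, he⟩ := (Nat.dvd_prime_pow hp).1 (orderOf_dvd_of_pow_eq_one hz)
  have : j ≤ k - 1 := by
    rcases Nat.lt_or_ge j k with h1 | h1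
    · omega
    · exact absurd (by rw [he]; congr 1; omega) h
  exact orderOf_dvd_iff_pow_eq_one.1 (he ▸ pow_dvd_pow p this)

open scoped Classical in
theorem auxA {F L : Type*} [Field F] [Field L] [CharZero L] [Algebra F L] (p k : ℕ)
    (hp : p.Prime) (hodd : Odd p) (hk : 2 ≤ k) (ζ : L) (hζ : IsPrimitiveRoot ζ (p ^ k))
    (σ : L ≃ₐ[F] L) (hσ : σ ^ p = 1) (hne : σ ζ ≠ ζ) (s : Multiset L)
    (hs : ∀ z ∈ s, z ^ p ^ k = 1) (hfix : σ s.sum = s.sum) :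
    (s.filter (fun z => orderOf z = p ^ k)).sum = 0 := by
  have : NeZero (p ^ k) := ⟨(pow_pos hp.pos k).ne'⟩
  obtain ⟨a, -, ha⟩ := hζ.eq_pow_of_pow_eq_one (ξ := σ ζ) (by rw [← map_pow, hζ.pow_eq_one, map_one])
  have hσz : ∀ z : L, z ^ p ^ k = 1 → σ z = z ^ a := by
    intro z hz
    obtain ⟨b, -, rfl⟩ := hζ.eq_pow_of_pow_eq_one hz
    rw [map_pow, ← ha, ← pow_mul, ← pow_mul, mul_comm]
  have hit : ∀ n : ℕ, (σ ^ n) ζ = ζ ^ (a ^ n) := by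
    intro n
    induction n with
    | zero => simp
    | succ n ih => rw [pow_succ', AlgEquiv.mul_apply, ih, map_pow, ← ha, ← pow_mul, pow_succ', mul_comm]
  have hmod : a ^ p ≡ 1 [MOD p ^ k] := by
    have := hit p
    rw [hσ, AlgEquiv.one_apply] at this
    have h2 : ζ ^ (a ^ p) = ζ ^ 1 := by rw [← this, pow_one]
    rw [(isOfFinOrder_iff_pow_eq_one.2 ⟨p ^ k, pow_pos hp.pos k, hζ.pow_eq_one⟩).pow_eq_pow_iff_modEq, ← hζ.eq_orderOf] at h2
    exact h2
  obtain ⟨c, rfl⟩ := aux_mod p k a hp hodd hk hmod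
  have hkk : p ^ k = p ^ (k-1) * p := by rw [← pow_succ]; congr 1; omega
  have hkk2 : p ^ (k-1) = p * p ^ (k-2) := by rw [← pow_succ']; congr 1; omega
  have hlow : ∀ z : L, z ^ p ^ (k-1) = 1 → σ z = z := by
    intro z hz
    rw [hσz z (by rw [hkk, pow_mul, hz, one_pow]), pow_add, pow_mul, hz, one_pow, pow_one, mul_one]
  have hc : ¬ p ∣ c := by
    rintro ⟨d, rfl⟩
    apply hne
    rw [hσz ζ hζ.pow_eq_one, ← mul_assoc, ← hkk, pow_add, pow_mul, hζ.pow_eq_one, one_pow, pow_one, mul_one]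
  have hprim : ∀ z : L, orderOf z = p ^ k → ∑ j ∈ Finset.range p, (σ ^ j) z = 0 := by
    intro z hz
    have hz1 : z ^ p ^ k = 1 := by rw [← hz, pow_orderOf_eq_one]
    set u := z ^ (p ^ (k-1) * c) with hu
    have hup : u ^ p = 1 := by
      rw [hu, ← pow_mul, mul_right_comm, ← hkk, pow_mul, hz1, one_pow]
    have hu1 : u ≠ 1 := by
      intro h
      have := orderOf_dvd_of_pow_eq_one h
      rw [hz, hkk] at this
      exact hc (Nat.dvd_of_mul_dvd_mul_left (pow_pos hp.pos _) this)
    have hσu : σ u = u := hlow u (by rw [hkk2, pow_mul, hup, one_pow])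
    have hj : ∀ j : ℕ, (σ ^ j) z = z * u ^ j := by
      intro j
      induction j with
      | zero => simp
      | succ j ih => rw [pow_succ', AlgEquiv.mul_apply, ih, map_mul, map_pow, hσu, hσz z hz1, pow_add, pow_one, ← hu, pow_succ', mul_assoc]
    simp_rw [hj]
    rw [← Finset.mul_sum]
    have := mul_geom_sum u p
    rw [hup, sub_self] at this
    rw [(mul_eq_zero.1 this).resolve_left (sub_ne_zero.2 hu1), mul_zero]
  set t := s.filter (fun z => orderOf z = p ^ k) with ht
  set r := s.filter (fun z => ¬ orderOf z = p ^ k) with hr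
  have htr : t.sum + r.sum = s.sum := by
    rw [← Multiset.sum_add, ht, hr, Multiset.filter_add_not]
  have hrfix : σ r.sum = r.sum := by
    rw [map_multiset_sum]
    congr 1
    conv_rhs => rw [← Multiset.map_id r]
    apply Multiset.map_congr rfl
    intro z hz
    rw [hr, Multiset.mem_filter] at hz
    exact hlow z (aux_ord p k hp hk z (hs z hz.1) hz.2)
  have htfix : σ t.sum = t.sum := by
    rw [← htr, map_add, hrfix] at hfix
    exact add_right_cancel hfix
  have htj : ∀ j : ℕ, (σ ^ j) t.sum = t.sum := by
    intro j
    induction j with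
    | zero => simp
    | succ j ih => rw [pow_succ', AlgEquiv.mul_apply, ih, htfix]
  have h0 : ∑ j ∈ Finset.range p, (σ ^ j) t.sum = 0 := by
    have : ∀ v : Multiset L, (∀ z ∈ v, orderOf z = p ^ k) → ∑ j ∈ Finset.range p, (σ ^ j) v.sum = 0 := by
      intro v
      induction v using Multiset.induction with
      | empty => simp
      | cons x v ih =>
        intro hv
        simp only [Multiset.sum_cons, map_add, Finset.sum_add_distrib]
        rw [hprim x (hv x (Multiset.mem_cons_self x v)), ih (fun z hz => hv z (Multiset.mem_cons_of_mem hz)), add_zero]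
    exact this t (fun z hz => (Multiset.mem_filter.1 hz).2)
  simp_rw [htj] at h0
  simpa [hp.ne_zero] using h0

open Polynomial in
theorem auxC (p k : ℕ) (hp : p.Prime) (hk : 2 ≤ k) (t : Multiset ℂ)
    (ht : ∀ z ∈ t, z ^ p ^ k = 1) (h0 : t.sum = 0) :
    p ∣ t.card ∧ ∀ T : Finset ℂ, (∀ z, z ∈ T ↔ z ∈ t) → p ∣ T.card := by
  classical
  have := Fact.mk hp
  have hpk : 0 < p ^ k := pow_pos hp.pos k
  have : NeZero (p ^ k) := ⟨hpk.ne'⟩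
  have hζ := Complex.isPrimitiveRoot_exp (p ^ k) hpk.ne'
  set ζ := Complex.exp (2 * Real.pi * Complex.I / ((p ^ k : ℕ) : ℂ))
  have hex : ∀ z : ℂ, ∃ n, z ^ p ^ k = 1 → n < p ^ k ∧ ζ ^ n = z := by
    intro z
    by_cases hz : z ^ p ^ k = 1
    · obtain ⟨n, h1, h2⟩ := hζ.eq_pow_of_pow_eq_one hz
      exact ⟨n, fun _ => ⟨h1, h2⟩⟩
    · exact ⟨0, fun h => absurd h hz⟩
  choose e he using hex
  set P : ℤ[X] := (t.map (fun z => (X : ℤ[X]) ^ e z)).sum with hP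
  have hcoeff : ∀ n, P.coeff n = (t.countP (fun z => e z = n) : ℤ) := by
    intro n
    rw [hP]
    clear h0 hP ht P
    induction t using Multiset.induction with
    | empty => simp
    | cons x t ih =>
      simp only [Multiset.map_cons, Multiset.sum_cons, coeff_add, ih, coeff_X_pow, Multiset.countP_cons]
      by_cases hx : e x = n
      · simp [hx, add_comm]
      · simp [hx, Ne.symm hx]
  have hdeg : P.degree < p ^ k := by
    rw [← Nat.cast_pow, degree_lt_iff_coeff_zero]
    intro n hn
    rw [hcoeff, Nat.cast_eq_zero, Multiset.countP_eq_zero]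
    rintro z hz rfl
    exact absurd (he z (ht z hz)).1 (by omega)
  have hev : aeval ζ P = 0 := by
    rw [← h0, hP, map_multiset_sum, Multiset.map_map]
    congr 1
    conv_rhs => rw [← Multiset.map_id t]
    apply Multiset.map_congr rfl
    intro z hz
    simpa using (he z (ht z hz)).2
  have hev1 : P.eval 1 = t.card := by
    have : P.eval 1 = evalRingHom 1 P := rfl
    rw [this, hP, map_multiset_sum, Multiset.map_map]
    simp
  obtain ⟨Q, hQ⟩ : cyclotomic (p ^ k) ℤ ∣ P := by
    rw [cyclotomic_eq_minpoly hζ hpk]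
    exact minpoly.isIntegrallyClosed_dvd (hζ.isIntegral hpk) hev
  have hkk : p ^ k = p ^ (k-1+1) := by congr 1; omega
  constructor
  · rw [hQ, eval_mul, hkk, eval_one_cyclotomic_prime_pow] at hev1
    exact Int.natCast_dvd_natCast.1 ⟨_, hev1.symm⟩
  · intro T hT
    set m := p ^ (k-1) with hm
    have hm0 : 0 < m := pow_pos hp.pos _
    have hQdeg : Q.degree < m := by
      by_cases hQ0 : Q = 0
      · rw [hQ0, degree_zero]; exact WithBot.bot_lt_coe _
      have hne : P ≠ 0 := by
        rw [hQ]; exact mul_ne_zero (cyclotomic_ne_zero _ _) hQ0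
      rw [degree_eq_natDegree hQ0, Nat.cast_lt]
      rw [degree_eq_natDegree hne, ← Nat.cast_pow, Nat.cast_lt, hQ, natDegree_mul (cyclotomic_ne_zero _ _) hQ0,
        natDegree_cyclotomic, hkk, Nat.totient_prime_pow_succ hp, pow_succ, ← hm] at hdeg
      obtain ⟨q, rfl⟩ : ∃ q, p = q + 1 := ⟨p - 1, by have := hp.pos; omega⟩
      rw [Nat.add_sub_cancel, mul_add] at hdeg
      omega
    have hPc : ∀ i j, i < m → j < p → P.coeff (i + m * j) = Q.coeff i := by
      intro i j hi hj
      rw [hQ, hkk, cyclotomic_prime_pow_eq_geom_sum hp, Finset.sum_mul, finsetSum_coeff,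
        Finset.sum_eq_single j]
      · rw [← pow_mul, coeff_X_pow_mul', if_pos (Nat.le_add_left _ _), Nat.add_sub_cancel]
      · intro b _ hb
        rw [← pow_mul, coeff_X_pow_mul']
        split_ifs with hle
        · apply coeff_eq_zero_of_degree_lt
          refine hQdeg.trans_le ?_
          rw [Nat.cast_le]
          have hbj : b < j := by
            rcases Nat.lt_or_ge b j with h | h
            · exact h
            · have : j + 1 ≤ b := by omega
              have := Nat.mul_le_mul_left m this
              rw [mul_add] at this
              change m * b ≤ _ at hle
              omega
          have := Nat.mul_le_mul_left m (show b + 1 ≤ j from hbj)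
          rw [mul_add] at this
          change m ≤ _ - m * b
          omega
        · rfl
      · intro h; exact absurd (Finset.mem_range.2 hj) h
    have hsupp : P.support = (Q.support ×ˢ Finset.range p).image (fun x => x.1 + m * x.2) := by
      ext n
      simp only [Finset.mem_image, Finset.mem_product, Finset.mem_range, Prod.exists, mem_support_iff]
      constructor
      · intro hn
        have hlt : n < p ^ k := by
          by_contra h
          apply hn
          apply coeff_eq_zero_of_degree_lt
          refine hdeg.trans_le ?_
          rw [← Nat.cast_pow, Nat.cast_le]; omega
        have h1 : n / m < p := by
          apply Nat.div_lt_of_lt_mul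
          rwa [hm, ← pow_succ, ← hkk]
        have h2 : n % m + m * (n / m) = n := Nat.mod_add_div n m
        refine ⟨n % m, n / m, ⟨?_, h1⟩, h2⟩
        rw [← hPc _ _ (Nat.mod_lt _ hm0) h1, h2]
        exact hn
      · rintro ⟨i, j, ⟨h1, h2⟩, rfl⟩
        rw [hPc i j _ h2]
        · exact h1
        · by_contra h
          apply h1
          apply coeff_eq_zero_of_degree_lt
          refine hQdeg.trans_le ?_
          rw [Nat.cast_le]; omega
    have hQi : ∀ i ∈ Q.support, i < m := by
      intro i hi
      by_contra h
      apply mem_support_iff.1 hi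
      apply coeff_eq_zero_of_degree_lt
      refine hQdeg.trans_le ?_
      rw [Nat.cast_le]; omega
    have hc1 : P.support.card = Q.support.card * p := by
      rw [hsupp, Finset.card_image_of_injOn, Finset.card_product, Finset.card_range]
      rintro ⟨i, j⟩ h1 ⟨i', j'⟩ h2 h
      simp only [Finset.coe_product, Set.mem_prod, Finset.mem_coe] at h1 h2
      simp only at h
      have hi := hQi _ h1.1
      have hi' := hQi _ h2.1
      have e1 : i = i' := by
        have := congrArg (· % m) h
        simpa [Nat.mod_eq_of_lt hi, Nat.mod_eq_of_lt hi'] using this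
      subst e1
      have : m * j = m * j' := by omega
      rw [Nat.eq_of_mul_eq_mul_left hm0 this]
    have hc2 : P.support = T.image e := by
      ext n
      rw [mem_support_iff, hcoeff, Ne, Nat.cast_eq_zero, ← Ne, ← Nat.pos_iff_ne_zero, Multiset.countP_pos]
      simp [hT]
    have hc3 : (T.image e).card = T.card := by
      apply Finset.card_image_of_injOn
      intro z hz w hw h
      rw [← (he z (ht z ((hT z).1 hz))).2, ← (he w (ht w ((hT w).1 hw))).2, h]
    rw [← hc3, ← hc2, hc1]
    exact dvd_mul_left _ _

instance auxCyc (n : ℕ) [NeZero n] : IsCyclotomicExtension {n} ℚ (Qcyc n) := by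
  have := IntermediateField.isCyclotomicExtension_adjoin_of_exists_isPrimitiveRoot {n} ℚ ℂ
    (fun m _ hm => ⟨_, Complex.isPrimitiveRoot_exp m hm⟩)
  have h : IntermediateField.adjoin ℚ {b : ℂ | ∃ m ∈ ({n} : Set ℕ), m ≠ 0 ∧ b ^ m = 1} = Qcyc n := by
    rw [Qcyc]; congr 1; ext z; simp [NeZero.ne n]
  rw [← h]; exact this

theorem auxRoot {N : ℕ} {z : ℂ} (h : z ^ N = 1) : z ∈ Qcyc N :=
  IntermediateField.subset_adjoin ℚ _ h

open scoped Classical in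
/-- for a multiset `s` of `p^k`-th roots of unity, `p` divides
`[ℚ(ζ_{p^k}) : ℚ(|s|)]` iff the sum of the entries of order exactly `p^k` vanishes.
In particular, if the number of entries of order exactly `p^k` (with multiplicity), or the
number of distinct such entries, is not divisible by `p`, then `p ∤ [ℚ(ζ_{p^k}) : ℚ(|s|)]`. -/
theorem stmt6 (p k : ℕ) (hp : p.Prime) (hodd : Odd p) (hk : 2 ≤ k)
    (s : Multiset ℂ) (hs : ∀ z ∈ s, z ^ p ^ k = 1) :
    (p ∣ (Qadj s.sum).relfinrank (Qcyc (p ^ k)) ↔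
      (s.filter (fun z => orderOf z = p ^ k)).sum = 0) ∧
    ((¬ p ∣ (s.filter (fun z => orderOf z = p ^ k)).card ∨
        ¬ p ∣ (s.toFinset.filter (fun z => orderOf z = p ^ k)).card) →
      ¬ p ∣ (Qadj s.sum).relfinrank (Qcyc (p ^ k))) := by
  have := Fact.mk hp
  have hpk : 0 < p ^ k := pow_pos hp.pos k
  have : NeZero (p ^ k) := ⟨hpk.ne'⟩
  have : NeZero (p ^ (k-1)) := ⟨(pow_pos hp.pos _).ne'⟩
  have hkk : p ^ k = p ^ (k-1) * p := by rw [← pow_succ]; congr 1; omega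
  have main : p ∣ (Qadj s.sum).relfinrank (Qcyc (p ^ k)) ↔
      (s.filter (fun z => orderOf z = p ^ k)).sum = 0 := by
    constructor
    · intro hdvd
      have hle : Qadj s.sum ≤ Qcyc (p ^ k) := by
        rw [Qadj, IntermediateField.adjoin_simple_le_iff]
        exact multiset_sum_mem _ (fun z hz => auxRoot (hs z hz))
      rw [IntermediateField.relfinrank_eq_finrank_of_le hle] at hdvd
      set E := IntermediateField.extendScalars hle with hE
      have hcyc : IsCyclotomicExtension {p ^ k} ℚ E :=
        inferInstanceAs (IsCyclotomicExtension {p ^ k} ℚ (Qcyc (p ^ k)))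
      have hgal : IsGalois ℚ E := IsCyclotomicExtension.isGalois {p ^ k} ℚ E
      have hfd : FiniteDimensional ℚ E := IsCyclotomicExtension.finiteDimensional {p ^ k} ℚ E
      have hgal' : IsGalois (Qadj s.sum) E := IsGalois.tower_top_of_isGalois ℚ _ E
      have hfd' : FiniteDimensional (Qadj s.sum) E := FiniteDimensional.right ℚ _ E
      rw [← IsGalois.card_aut_eq_finrank] at hdvd
      obtain ⟨σ, hσ⟩ := exists_prime_orderOf_dvd_card' p hdvd
      have hζ := IsCyclotomicExtension.zeta_spec (p ^ k) ℚ E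
      set ζ := IsCyclotomicExtension.zeta (p ^ k) ℚ E
      have hne : σ ζ ≠ ζ := by
        intro h
        have h1 : σ = 1 := by
          have h2 : (σ.restrictScalars ℚ).toAlgHom = AlgHom.id ℚ E := by
            apply AlgHom.ext_of_adjoin_eq_top (IsCyclotomicExtension.adjoin_primitive_root_eq_top hζ)
            rintro x rfl
            exact h
          ext x
          exact congrArg Subtype.val (DFunLike.congr_fun h2 x)
        rw [h1, orderOf_one] at hσ
        exact hp.one_lt.ne hσ
      obtain ⟨t, hts⟩ : ∃ t : Multiset E, t.map Subtype.val = s := by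
        refine ⟨s.attach.map (fun z => (⟨z.1, auxRoot (hs z.1 z.2)⟩ : E)), ?_⟩
        rw [Multiset.map_map]
        exact Multiset.attach_map_val s
      have hval : ∀ v : Multiset E, (v.map Subtype.val).sum = ((v.sum : E) : ℂ) := fun v =>
        (map_multiset_sum E.val v).symm
      have hfix : σ t.sum = t.sum := by
        have hmem : s.sum ∈ Qadj s.sum :=
          IntermediateField.mem_adjoin_simple_self ℚ _
        have : t.sum = algebraMap (Qadj s.sum) E ⟨_, hmem⟩ := by
          apply Subtype.ext
          rw [← hval, hts]
          rfl
        rw [this, AlgEquiv.commutes]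
      have hmemt : ∀ z ∈ t, (z : ℂ) ∈ s := fun z hz => by
        have := Multiset.mem_map_of_mem Subtype.val hz
        rwa [hts] at this
      have key := auxA p k hp hodd hk ζ hζ σ (by rw [← hσ, pow_orderOf_eq_one]) hne t
        (fun z hz => Subtype.ext (by simpa using hs z.1 (hmemt z hz))) hfix
      have hord : ∀ z : E, orderOf (z : ℂ) = orderOf z := fun z =>
        orderOf_injective (E.val : E →* ℂ) Subtype.val_injective z
      rw [← hts, Multiset.filter_map, hval]
      simp only [Function.comp_def, hord]
      rw [key]; rfl
    · intro h0
      have hmem : s.sum ∈ Qcyc (p ^ (k-1)) := by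
        rw [← Multiset.filter_add_not (fun z => orderOf z = p ^ k) s, Multiset.sum_add, h0, zero_add]
        refine multiset_sum_mem _ (fun z hz => ?_)
        rw [Multiset.mem_filter] at hz
        exact auxRoot (aux_ord p k hp hk z (hs z hz.1) hz.2)
      have hle1 : Qadj s.sum ≤ Qcyc (p ^ (k-1)) := by
        rw [Qadj, IntermediateField.adjoin_simple_le_iff]; exact hmem
      have hle2 : Qcyc (p ^ (k-1)) ≤ Qcyc (p ^ k) := by
        apply IntermediateField.adjoin.mono
        intro z hz
        change z ^ _ = 1 at hz ⊢
        rw [hkk, pow_mul, hz, one_pow]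
      have hrel : (Qcyc (p ^ (k-1))).relfinrank (Qcyc (p ^ k)) = p := by
        have h1 := IntermediateField.finrank_bot_mul_relfinrank hle2
        rw [IsCyclotomicExtension.Rat.finrank (p ^ (k-1)), IsCyclotomicExtension.Rat.finrank (p ^ k),
          Nat.totient_prime_pow hp (by omega), Nat.totient_prime_pow hp (by omega)] at h1
        have hpos : 0 < p ^ (k-1-1) * (p-1) :=
          Nat.mul_pos (pow_pos hp.pos _) (by have := hp.one_lt; omega)
        apply Nat.eq_of_mul_eq_mul_left hpos
        rw [h1, mul_right_comm, ← pow_succ]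
        congr 2; omega
      rw [← IntermediateField.relfinrank_mul_relfinrank hle1 hle2, hrel]
      exact dvd_mul_left _ _
  refine ⟨main, fun hor hd => ?_⟩
  obtain ⟨h1, h2⟩ := auxC p k hp hk _ (fun z hz => hs z (Multiset.mem_filter.1 hz).1) (main.1 hd)
  rcases hor with h | h
  · exact h h1
  · exact h (h2 _ (fun z => by simp))
end

section
/- Let G be a finite group, p an odd prime, and χ an irreducible complex character of G with p ∤ χ(1). Let f be the conductor of χ and assume p² divides f. Then Property 1.3 holds for (G, χ, p) if and only if there exists a p-element g ∈ G such that the p-part of f equals the p-part of the conductor of the value χ(g), i.e., (f_χ)_p = (f_{χ(g)})_p. -/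
open CategoryTheory

theorem Qcyc_isCyc (n : ℕ) [NeZero n] : IsCyclotomicExtension {n} ℚ (Qcyc n) := by
  have h := IntermediateField.isCyclotomicExtension_adjoin_of_exists_isPrimitiveRoot
    {n} ℚ ℂ (fun m hm h0 => ⟨_, Complex.isPrimitiveRoot_exp m h0⟩)
  have e : {b : ℂ | ∃ m ∈ ({n} : Set ℕ), m ≠ 0 ∧ b ^ m = 1} = {z : ℂ | z ^ n = 1} := by
    ext z; simp [NeZero.ne n]
  rw [e] at h
  exact h

theorem Qcyc_finrank (n : ℕ) [NeZero n] : Module.finrank ℚ (Qcyc n) = n.totient := by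
  have := Qcyc_isCyc n
  exact IsCyclotomicExtension.finrank (n := n) (K := ℚ) (Qcyc n)
    (Polynomial.cyclotomic.irreducible_rat (NeZero.pos n))

theorem Qcyc_mono {m n : ℕ} (h : m ∣ n) : Qcyc m ≤ Qcyc n := by
  apply IntermediateField.adjoin.mono
  rintro z (hz : z ^ m = 1)
  obtain ⟨k, rfl⟩ := h
  change z ^ (m * k) = 1
  rw [pow_mul, hz, one_pow]

theorem finrank_sup_mul_inf {K L : Type*} [Field K] [Field L] [Algebra K L]
    (A B : IntermediateField K L) [IsGalois K A] [FiniteDimensional K A] [FiniteDimensional K B] :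
    Module.finrank K (A ⊔ B : IntermediateField K L) *
      Module.finrank K (A ⊓ B : IntermediateField K L) =
      Module.finrank K A * Module.finrank K B := by
  have hA : A ⊓ B ≤ A := inf_le_left
  have hB : A ⊓ B ≤ B := inf_le_right
  have hS : A ⊓ B ≤ A ⊔ B := hA.trans le_sup_left
  let A' := IntermediateField.extendScalars hA
  let B' := IntermediateField.extendScalars hB
  have : IsGalois K A' := (inferInstance : IsGalois K A)
  have : FiniteDimensional K A' := (inferInstance : FiniteDimensional K A)
  have : FiniteDimensional K B' := (inferInstance : FiniteDimensional K B)
  have : IsGalois (A ⊓ B : IntermediateField K L) A' := IsGalois.tower_top_of_isGalois K _ _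
  have : FiniteDimensional (A ⊓ B : IntermediateField K L) A' :=
    FiniteDimensional.right K _ _
  have : FiniteDimensional (A ⊓ B : IntermediateField K L) B' :=
    FiniteDimensional.right K _ _
  have hbot : A' ⊓ B' = ⊥ := by
    rw [IntermediateField.extendScalars_inf]
    rw [eq_bot_iff]
    intro x hx
    exact IntermediateField.mem_bot.2 ⟨⟨x, hx⟩, rfl⟩
  have h := (IntermediateField.LinearDisjoint.of_inf_eq_bot (A := A') (B := B') hbot).finrank_sup
  rw [IntermediateField.extendScalars_sup,
    ← IntermediateField.relfinrank_eq_finrank_of_le,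
    ← IntermediateField.relfinrank_eq_finrank_of_le,
    ← IntermediateField.relfinrank_eq_finrank_of_le] at h
  rw [← IntermediateField.finrank_bot_mul_relfinrank hA,
    ← IntermediateField.finrank_bot_mul_relfinrank hB,
    ← IntermediateField.finrank_bot_mul_relfinrank hS, h]
  ring

theorem totient_lcm_mul_gcd (a b : ℕ) (ha : 0 < a) :
    (a.lcm b).totient * (a.gcd b).totient = a.totient * b.totient := by
  have h1 := Nat.totient_gcd_mul_totient_mul a b
  have h2 := Nat.totient_gcd_mul_totient_mul (a.gcd b) (a.lcm b)
  have hg : 0 < a.gcd b := Nat.gcd_pos_of_pos_left _ ha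
  rw [Nat.gcd_mul_lcm, Nat.gcd_eq_left ((Nat.gcd_dvd_left a b).trans (Nat.dvd_lcm_left a b)), h1]
    at h2
  have := Nat.eq_of_mul_eq_mul_right hg h2
  rw [this, mul_comm]

theorem cyc_inf_gen {K L : Type*} [Field K] [Field L] [Algebra K L]
    (hirr : ∀ n, 0 < n → Irreducible (Polynomial.cyclotomic n K))
    {m n : ℕ} (hm : 0 < m) (hn : 0 < n) (A B C : IntermediateField K L)
    (hA : IsCyclotomicExtension {m} K A) (hB : IsCyclotomicExtension {n} K B)
    (hC : IsCyclotomicExtension {m.gcd n} K C) : A ⊓ B = C := by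
  have : NeZero m := ⟨hm.ne'⟩
  have : NeZero n := ⟨hn.ne'⟩
  have hg := Nat.gcd_pos_of_pos_left n hm
  have hl := Nat.lcm_pos hm hn
  have : NeZero (m.gcd n) := ⟨hg.ne'⟩
  have : NeZero (m.lcm n) := ⟨hl.ne'⟩
  have := IsCyclotomicExtension.finite_of_singleton m K A
  have := IsCyclotomicExtension.finite_of_singleton n K B
  have := IsCyclotomicExtension.isGalois {m} K A
  have := IntermediateField.isCyclotomicExtension_lcm_sup K L m n A B
  have h := finrank_sup_mul_inf A B
  rw [IsCyclotomicExtension.finrank (n := m.lcm n) (K := K) _ (hirr _ hl),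
    IsCyclotomicExtension.finrank (n := m) (K := K) A (hirr _ hm),
    IsCyclotomicExtension.finrank (n := n) (K := K) B (hirr _ hn),
    ← totient_lcm_mul_gcd m n hm] at h
  have h' := Nat.eq_of_mul_eq_mul_left (Nat.totient_pos.2 (NeZero.pos _)) h
  have hle : C ≤ A ⊓ B :=
    le_inf (IntermediateField.isCyclotomicExtension_le_of_dvd K L (m.gcd n) m C A
        (Nat.gcd_dvd_left _ _))
      (IntermediateField.isCyclotomicExtension_le_of_dvd K L (m.gcd n) n C B
        (Nat.gcd_dvd_right _ _))
  have : FiniteDimensional K (A ⊓ B : IntermediateField K L) :=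
    FiniteDimensional.of_injective (IntermediateField.inclusion
      (inf_le_left : A ⊓ B ≤ A)).toLinearMap (IntermediateField.inclusion_injective inf_le_left)
  exact (IntermediateField.eq_of_le_of_finrank_eq hle (by
    rw [h', IsCyclotomicExtension.finrank (n := m.gcd n) (K := K) C (hirr _ hg)])).symm

theorem Qcyc_inf {m n : ℕ} (hm : 0 < m) (hn : 0 < n) : Qcyc m ⊓ Qcyc n = Qcyc (m.gcd n) := by
  have : NeZero m := ⟨hm.ne'⟩
  have : NeZero n := ⟨hn.ne'⟩
  have : NeZero (m.gcd n) := ⟨(Nat.gcd_pos_of_pos_left _ hm).ne'⟩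
  exact cyc_inf_gen (fun n hn => Polynomial.cyclotomic.irreducible_rat hn) hm hn _ _ _
    (Qcyc_isCyc m) (Qcyc_isCyc n) (Qcyc_isCyc (m.gcd n))

theorem trace_mem_Qcyc {V : Type*} [AddCommGroup V] [Module ℂ V] [FiniteDimensional ℂ V]
    (T : Module.End ℂ V) (n : ℕ) (hT : T ^ n = 1) : LinearMap.trace ℂ V T ∈ Qcyc n := by
  let b := Module.finBasis ℂ V
  rw [LinearMap.trace_eq_matrix_trace ℂ b, Matrix.trace_eq_sum_roots_charpoly,
    LinearMap.charpoly_toMatrix]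
  apply multiset_sum_mem
  intro μ hμ
  apply IntermediateField.subset_adjoin
  have h1 : T.HasEigenvalue μ := by
    rw [Module.End.hasEigenvalue_iff_isRoot_charpoly]
    exact Polynomial.isRoot_of_mem_roots hμ
  obtain ⟨v, hv⟩ := h1.exists_hasEigenvector
  have h2 := hv.pow_apply n
  rw [hT] at h2
  have h3 : (μ ^ n - 1) • v = 0 := by
    rw [sub_smul, one_smul, ← h2]; simp
  exact sub_eq_zero.1 ((smul_eq_zero.1 h3).resolve_right hv.2)

theorem cyclic_subgroup_le {C : Type*} [Group C] [Finite C] [IsCyclic C] (H K : Subgroup C)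
    (h : Nat.card H ∣ Nat.card K) : H ≤ K := by
  classical
  have := Fintype.ofFinite C
  have hc := IsCyclic.card_pow_eq_one_le (α := C) (n := Nat.card K) Nat.card_pos
  have hsub : (Finset.univ.filter (fun x : C => x ∈ K)) ⊆
      Finset.univ.filter (fun x : C => x ^ Nat.card K = 1) := by
    intro x hx
    simp only [Finset.mem_filter, Finset.mem_univ, true_and] at hx ⊢
    exact orderOf_dvd_iff_pow_eq_one.1 (Subgroup.orderOf_dvd_natCard K hx)
  have hcard : (Finset.univ.filter (fun x : C => x ∈ K)).card = Nat.card K := by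
    rw [Nat.card_eq_fintype_card, Fintype.card_subtype]
  have heq := Finset.eq_of_subset_of_card_le hsub (by rw [hcard]; exact hc)
  intro x hx
  have : x ∈ Finset.univ.filter (fun x : C => x ^ Nat.card K = 1) := by
    simp only [Finset.mem_filter, Finset.mem_univ, true_and]
    exact orderOf_dvd_iff_pow_eq_one.1 ((Subgroup.orderOf_dvd_natCard H hx).trans h)
  rw [← heq] at this
  simpa using this

theorem relfinrank_restrict {K L : Type*} [Field K] [Field L] [Algebra K L]
    {A E : IntermediateField K L} (h : A ≤ E) :
    A.relfinrank E = Module.finrank (IntermediateField.restrict h) E := by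
  have h1 := IntermediateField.finrank_comap A E.val
  rw [IntermediateField.fieldRange_val] at h1
  rw [← h1]
  have : A.comap E.val = IntermediateField.restrict h := by
    ext x
    rw [IntermediateField.mem_restrict]; rfl
  rw [this]

theorem Qcyc_relfinrank (p : ℕ) (hp : p.Prime) (k : ℕ) :
    (Qcyc (p ^ (k + 1))).relfinrank (Qcyc (p ^ (k + 2))) = p := by
  have : NeZero p := ⟨hp.ne_zero⟩
  have h := IntermediateField.finrank_bot_mul_relfinrank
    (Qcyc_mono (pow_dvd_pow p (by omega : k + 1 ≤ k + 2)))
  rw [Qcyc_finrank, Qcyc_finrank, Nat.totient_prime_pow_succ hp,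
    Nat.totient_prime_pow_succ hp, pow_succ, mul_assoc, mul_assoc] at h
  have h1 : 0 < p - 1 := Nat.sub_pos_of_lt hp.one_lt
  have h2 := Nat.eq_of_mul_eq_mul_left (pow_pos hp.pos k) h
  rw [mul_comm p] at h2
  exact Nat.eq_of_mul_eq_mul_left h1 h2

theorem le_of_dvd_gen {K L : Type*} [Field K] [Field L] [Algebra K L]
    (n : ℕ) (hn : 0 < n) (hirr : Irreducible (Polynomial.cyclotomic n K))
    (hcyc : IsCyclic (ZMod n)ˣ) (E F M : IntermediateField K L)
    (hE : IsCyclotomicExtension {n} K E) (hF : F ≤ E) (hM : M ≤ E)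
    (hd : M.relfinrank E ∣ F.relfinrank E) : F ≤ M := by
  have : NeZero n := ⟨hn.ne'⟩
  rw [relfinrank_restrict hF, relfinrank_restrict hM] at hd
  have := IsCyclotomicExtension.finite_of_singleton n K E
  have := IsCyclotomicExtension.isGalois {n} K E
  let e := IsCyclotomicExtension.autEquivPow (n := n) (K := K) E hirr
  have : IsCyclic Gal(E/K) := e.isCyclic.2 hcyc
  have hle := cyclic_subgroup_le (IntermediateField.restrict hM).fixingSubgroup
    (IntermediateField.restrict hF).fixingSubgroup
    (by rwa [IsGalois.card_fixingSubgroup_eq_finrank, IsGalois.card_fixingSubgroup_eq_finrank])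
  rw [← IntermediateField.le_iff_le, IsGalois.fixedField_fixingSubgroup] at hle
  intro x hx
  have := hle ((IntermediateField.mem_restrict hF ⟨x, hF hx⟩).2 hx)
  exact (IntermediateField.mem_restrict hM _).1 this

theorem le_of_dvd_relfinrank (p : ℕ) (hp : p.Prime) (hodd : Odd p) (k : ℕ)
    (F : IntermediateField ℚ ℂ) (hF : F ≤ Qcyc (p ^ (k + 2)))
    (hd : p ∣ F.relfinrank (Qcyc (p ^ (k + 2)))) : F ≤ Qcyc (p ^ (k + 1)) := by
  have : NeZero p := ⟨hp.ne_zero⟩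
  exact le_of_dvd_gen (p ^ (k + 2)) (NeZero.pos _)
    (Polynomial.cyclotomic.irreducible_rat (NeZero.pos _))
    (ZMod.isCyclic_units_of_prime_pow p hp (by rintro rfl; exact absurd hodd (by decide)) _)
    (Qcyc (p ^ (k + 2))) F _ (Qcyc_isCyc _) hF
    (Qcyc_mono (pow_dvd_pow p (by omega : k + 1 ≤ k + 2)))
    (by rw [Qcyc_relfinrank p hp k]; exact hd)

theorem conductor_unique {S : Set ℕ} {a b : ℕ} (ha : IsLeast S a) (hb : IsLeast S b) : a = b :=
  ha.unique hb

theorem exists_conductor (c : ℂ) (n : ℕ) (hn : 0 < n) (h : c ∈ Qcyc n) :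
    ∃ f, IsConductorOf c f := by
  classical
  have hne : ∃ N, 0 < N ∧ c ∈ Qcyc N := ⟨n, hn, h⟩
  exact ⟨Nat.find hne, Nat.find_spec hne, fun m hm => Nat.find_min' hne hm⟩

theorem conductor_dvd {c : ℂ} {f n : ℕ} (hf : IsConductorOf c f) (hn : 0 < n) (h : c ∈ Qcyc n) :
    f ∣ n := by
  have h1 : c ∈ Qcyc f ⊓ Qcyc n := ⟨hf.1.2, h⟩
  rw [Qcyc_inf hf.1.1 hn] at h1
  have h2 := hf.2 ⟨Nat.gcd_pos_of_pos_left _ hf.1.1, h1⟩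
  have h3 : f.gcd n = f := le_antisymm (Nat.gcd_le_left _ hf.1.1) h2
  exact h3 ▸ Nat.gcd_dvd_right f n

theorem key (p : ℕ) (hp : p.Prime) (hodd : Odd p) (k : ℕ) (c : ℂ) (j f : ℕ) (hfpos : 0 < f)
    (hj : c ∈ Qcyc (p ^ j)) (hcf : c ∈ Qcyc f) (ha : f.factorization p = k + 2) :
    (¬ p ∣ (Qadj c).relfinrank (Qcyc (p ^ (k + 2)))) ↔
      ∃ fg : ℕ, IsConductorOf c fg ∧ fg.factorization p = k + 2 := by
  obtain ⟨fg, hfg⟩ := exists_conductor c _ (pow_pos hp.pos j) hj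
  obtain ⟨b, -, rfl⟩ := (Nat.dvd_prime_pow hp).1 (conductor_dvd hfg (pow_pos hp.pos j) hj)
  have hb : b ≤ k + 2 := by
    have := conductor_dvd hfg hfpos hcf
    rwa [hp.pow_dvd_iff_le_factorization hfpos.ne', ha] at this
  have hex : (∃ fg : ℕ, IsConductorOf c fg ∧ fg.factorization p = k + 2) ↔ b = k + 2 := by
    constructor
    · rintro ⟨f', hf', h⟩
      rw [conductor_unique hf' hfg, hp.factorization_pow] at h
      simpa using h
    · intro h
      exact ⟨_, hfg, by rw [hp.factorization_pow]; simpa using h⟩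
  rw [hex]
  have hsub : ∀ F : IntermediateField ℚ ℂ, Qadj c ≤ F ↔ c ∈ F := fun F => by
    simp [Qadj]
  constructor
  · intro h
    by_contra hne
    apply h
    have hle : Qadj c ≤ Qcyc (p ^ (k + 1)) :=
      (hsub _).2 (Qcyc_mono (pow_dvd_pow p (by omega)) hfg.1.2)
    have := IntermediateField.relfinrank_dvd_of_le_left (Qcyc (p ^ (k + 2))) hle
    rwa [Qcyc_relfinrank p hp k] at this
  · rintro rfl hd
    have h1 := le_of_dvd_relfinrank p hp hodd k (Qadj c) ((hsub _).2 hfg.1.2) hd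
    have h2 := conductor_dvd hfg (pow_pos hp.pos _) ((hsub _).1 h1)
    have := (Nat.pow_dvd_pow_iff_le_right hp.one_lt).1 h2
    omega

/-- for an irreducible character `χ` of `p'`-degree whose conductor `f` is
divisible by `p²`, Property 1.3 holds for `(G, χ, p)` iff there is a `p`-element `g ∈ G`
such that the `p`-part of `f` equals the `p`-part of the conductor of `χ(g)`. -/
theorem stmt7 (G : Type) [Group G] [Finite G] (p : ℕ) (hp : p.Prime) (hodd : Odd p)
    (V : FDRep ℂ G) (hV : Simple V) (hdeg : ¬ p ∣ Module.finrank ℂ V)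
    (f : ℕ) (hf : IsCharConductor V.character f) (hp2 : p ^ 2 ∣ f) :
    Property13 V.character p ↔
      ∃ g : G, (∃ j : ℕ, orderOf g = p ^ j) ∧
        ∃ fg : ℕ, IsConductorOf (V.character g) fg ∧
          fg.factorization p = f.factorization p := by
  have hfpos : 0 < f := hf.1.1
  obtain ⟨k, hk⟩ : ∃ k, f.factorization p = k + 2 := by
    rw [hp.pow_dvd_iff_le_factorization hfpos.ne'] at hp2
    exact ⟨f.factorization p - 2, by omega⟩
  have hkey : ∀ g : G, (∃ j : ℕ, orderOf g = p ^ j) →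
      ((¬ p ∣ (Qadj (V.character g)).relfinrank (Qcyc (p ^ (k + 2)))) ↔
        ∃ fg : ℕ, IsConductorOf (V.character g) fg ∧ fg.factorization p = k + 2) := by
    rintro g ⟨j, hj⟩
    refine key p hp hodd k _ j f hfpos ?_ (hf.1.2 g) hk
    apply trace_mem_Qcyc
    rw [← map_pow, ← hj, pow_orderOf_eq_one, map_one]
  have hprop : Property13 V.character p ↔ ∃ g : G, (∃ j : ℕ, orderOf g = p ^ j) ∧
      ¬ p ∣ (Qadj (V.character g)).relfinrank (Qcyc (p ^ (k + 2))) := by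
    constructor
    · intro h
      have := h f hf
      rwa [hk] at this
    · intro h f' hf'
      rw [conductor_unique hf' hf, hk]
      exact h
  rw [hprop, hk]
  exact exists_congr fun g => and_congr_right fun hg => hkey g hg
end

section
/- Let q ≥ 4 be a prime power and let G = SL_2(F_q), the group of 2×2 matrices of determinant 1 over the field with q elements. Then for every odd prime p and every irreducible complex character χ of G with p ∤ χ(1), Property 1.3 holds for (G, χ, p). -/
open CategoryTheory

/-! ### Field theory -/

lemma lift_aux {A B C : Type*} [CommRing A] [IsDomain A] [Field B] [Field C] [IsAlgClosed C]
    [Algebra A B] [Algebra.IsAlgebraic A B] [Module.IsTorsionFree A B]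
    (g : A →+* C) (hg : Function.Injective g) :
    ∃ L : B →+* C, ∀ a, L (algebraMap A B a) = g a := by
  let _ : Algebra A C := g.toAlgebra
  have : FaithfulSMul A C := (faithfulSMul_iff_algebraMap_injective A C).2 hg
  let L : B →ₐ[A] C := IsAlgClosed.lift
  exact ⟨L, fun a => L.commutes a⟩

lemma endo_extend (K : IntermediateField ℚ ℂ) (τ : Gal(K/ℚ)) :
    ∃ σ : ℂ →ₐ[ℚ] ℂ, ∀ x : K, σ (x : ℂ) = (τ x : ℂ) := by
  obtain ⟨ι, v, hv⟩ := exists_isTranscendenceBasis' K ℂ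
  have halg := hv.isAlgebraic
  let f : MvPolynomial ι K →+* ℂ :=
    ((MvPolynomial.aeval v : MvPolynomial ι K →ₐ[K] ℂ) : MvPolynomial ι K →+* ℂ).comp
      (MvPolynomial.map (τ : K →+* K))
  have hf : Function.Injective f := by
    refine Function.Injective.comp (g := (MvPolynomial.aeval v : MvPolynomial ι K →ₐ[K] ℂ)) hv.1 ?_
    exact MvPolynomial.map_injective _ (τ : K →+* K).injective
  let e : Algebra.adjoin K (Set.range v) ≃ₐ[K] MvPolynomial ι K := hv.1.aevalEquiv.symm
  let g : Algebra.adjoin K (Set.range v) →+* ℂ :=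
    f.comp (e : Algebra.adjoin K (Set.range v) →+* MvPolynomial ι K)
  have hg : Function.Injective g := hf.comp e.injective
  obtain ⟨L, hL⟩ := lift_aux (B := ℂ) g hg
  refine ⟨L.toRatAlgHom, fun x => ?_⟩
  have h2 := hL (algebraMap K _ x)
  change L (x : ℂ) = f (e (algebraMap K _ x)) at h2
  change L (x : ℂ) = _
  rw [h2, e.commutes]
  simp [f, MvPolynomial.algebraMap_eq]

lemma endo_agree (d : ℕ) (f g : ℂ →ₐ[ℚ] ℂ) (h : ∀ z : ℂ, z ^ d = 1 → f z = g z)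
    (x : ℂ) (hx : x ∈ Qcyc d) : f x = g x := by
  have : f.comp (Qcyc d).val = g.comp (Qcyc d).val :=
    IntermediateField.algHom_ext_of_eq_adjoin ℚ rfl (fun z hz => h z hz)
  exact DFunLike.congr_fun this ⟨x, hx⟩

lemma root_mem_Qcyc {d : ℕ} {z : ℂ} (hz : z ^ d = 1) : z ∈ Qcyc d :=
  IntermediateField.subset_adjoin _ _ hz

lemma Qcyc_mono_s8 {d N : ℕ} (h : d ∣ N) : Qcyc d ≤ Qcyc N := by
  apply IntermediateField.adjoin.mono
  intro z hz
  obtain ⟨k, rfl⟩ := h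
  simp only [Set.mem_ofPred_eq] at *
  rw [pow_mul, hz, one_pow]

instance Qcyc_cyc (N : ℕ) [NeZero N] : IsCyclotomicExtension {N} ℚ (Qcyc N) := by
  have := IntermediateField.isCyclotomicExtension_adjoin_of_exists_isPrimitiveRoot {N} ℚ ℂ
    (fun n hn h0 => ⟨_, Complex.isPrimitiveRoot_exp n h0⟩)
  have h2 : {b : ℂ | ∃ n ∈ ({N} : Set ℕ), n ≠ 0 ∧ b ^ n = 1} = {z : ℂ | z ^ N = 1} := by
    ext z; simp [NeZero.ne N]
  rw [h2] at this
  exact this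

instance Qcyc_nf (N : ℕ) [NeZero N] : NumberField (Qcyc N) :=
  IsCyclotomicExtension.numberField {N} ℚ (Qcyc N)

instance Qcyc_gal (N : ℕ) [NeZero N] : IsGalois ℚ (Qcyc N) :=
  IsCyclotomicExtension.isGalois {N} ℚ (Qcyc N)

lemma gal_fixed {N d : ℕ} [NeZero N] (hd : d ∣ N) (x : Qcyc N) (hx' : (x : ℂ) ∉ Qcyc d) :
    ∃ τ : Gal(Qcyc N/ℚ), (∀ y : Qcyc N, (y : ℂ) ∈ Qcyc d → τ y = y) ∧ τ x ≠ x := by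
  by_contra hcon
  push Not at hcon
  let K' : IntermediateField ℚ (Qcyc N) := IntermediateField.restrict (Qcyc_mono_s8 hd)
  have hK : ∀ y : Qcyc N, y ∈ K' ↔ (y : ℂ) ∈ Qcyc d := fun y =>
    IntermediateField.mem_restrict (Qcyc_mono_s8 hd) y
  have h1 : x ∈ IntermediateField.fixedField K'.fixingSubgroup := by
    rw [IntermediateField.mem_fixedField_iff]
    intro f hf
    apply hcon
    intro y hy
    rw [IntermediateField.mem_fixingSubgroup_iff] at hf
    exact hf y ((hK y).2 hy)
  rw [IsGalois.fixedField_fixingSubgroup] at h1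
  exact hx' ((hK x).1 h1)

lemma endo_fixed {N d : ℕ} (hN : 0 < N) (hd : d ∣ N) (x : ℂ) (hx : x ∈ Qcyc N)
    (hx' : x ∉ Qcyc d) :
    ∃ σ : ℂ →ₐ[ℚ] ℂ, (∀ y ∈ Qcyc d, σ y = y) ∧ σ x ≠ x := by
  have : NeZero N := ⟨hN.ne'⟩
  obtain ⟨τ, h1, h2⟩ := gal_fixed hd ⟨x, hx⟩ hx'
  obtain ⟨σ, hσ⟩ := endo_extend (Qcyc N) τ
  refine ⟨σ, fun y hy => ?_, fun h => h2 ?_⟩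
  · have := hσ ⟨y, Qcyc_mono_s8 hd hy⟩
    have h3 := h1 ⟨y, Qcyc_mono_s8 hd hy⟩ hy
    rw [h3] at this
    exact this
  · have := hσ ⟨x, hx⟩
    apply Subtype.ext
    exact this.symm.trans h

lemma endo_exists (N : ℕ) (hN : 0 < N) (s : ℕ) (hs : s.Coprime N) :
    ∃ σ : ℂ →ₐ[ℚ] ℂ, ∀ z : ℂ, z ^ N = 1 → σ z = z ^ s := by
  have : NeZero N := ⟨hN.ne'⟩
  let τ := (IsCyclotomicExtension.Rat.galEquivZMod N (Qcyc N)).symm (ZMod.unitOfCoprime s hs)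
  obtain ⟨σ, hσ⟩ := endo_extend (Qcyc N) τ
  refine ⟨σ, fun z hz => ?_⟩
  have h1 := hσ ⟨z, root_mem_Qcyc hz⟩
  have h2 := IsCyclotomicExtension.Rat.galEquivZMod_apply_of_pow_eq N (Qcyc N) τ
    (x := ⟨z, root_mem_Qcyc hz⟩) (by ext; simpa using hz)
  rw [h2] at h1
  change σ z = _ at h1
  rw [h1]
  simp only [τ, MulEquiv.apply_symm_apply, ZMod.coe_unitOfCoprime, ZMod.val_natCast]
  change z ^ (s % N) = z ^ s
  exact (pow_eq_pow_mod s hz).symm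

lemma endo_pow (N : ℕ) (hN : 0 < N) (σ : ℂ →ₐ[ℚ] ℂ) :
    ∃ s : ℕ, s.Coprime N ∧ ∀ z : ℂ, z ^ N = 1 → σ z = z ^ s := by
  have : NeZero N := ⟨hN.ne'⟩
  have hζ := Complex.isPrimitiveRoot_exp N hN.ne'
  set ζ := Complex.exp (2 * Real.pi * Complex.I / N)
  have h2 : IsPrimitiveRoot (σ ζ) N := hζ.map_of_injective σ.injective
  obtain ⟨s, -, hs⟩ := hζ.eq_pow_of_pow_eq_one h2.pow_eq_one
  refine ⟨s, ?_, fun z hz => ?_⟩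
  · rw [← hs] at h2
    exact (hζ.pow_iff_coprime hN s).1 h2
  · obtain ⟨i, -, rfl⟩ := hζ.eq_pow_of_pow_eq_one hz
    rw [map_pow, ← hs, ← pow_mul, ← pow_mul, mul_comm]

/-- if `z ↦ z^s` fixes `d`-th roots of unity then `s ≡ 1 mod d`. -/
lemma modEq_of_fix (d : ℕ) (hd : 0 < d) (s : ℕ) (h : ∀ z : ℂ, z ^ d = 1 → z ^ s = z) :
    s ≡ 1 [MOD d] := by
  have hζ := Complex.isPrimitiveRoot_exp d hd.ne'
  have := h _ hζ.pow_eq_one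
  set ζ := Complex.exp (2 * Real.pi * Complex.I / d)
  have h0 : ζ ≠ 0 := Complex.exp_ne_zero _
  have h1 : (Units.mk0 ζ h0) ^ s = (Units.mk0 ζ h0) ^ 1 := by
    ext; simpa using this
  have h3 := (pow_eq_pow_iff_modEq).1 h1
  rwa [← orderOf_units, Units.val_mk0, ← hζ.eq_orderOf] at h3

lemma Qcyc_inf_s8 {a b : ℕ} (ha : 0 < a) (hb : 0 < b) {x : ℂ} (hxa : x ∈ Qcyc a)
    (hxb : x ∈ Qcyc b) : x ∈ Qcyc (a.gcd b) := by
  by_contra hcon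
  obtain ⟨σ, h1, h2⟩ := endo_fixed ha (Nat.gcd_dvd_left a b) x hxa hcon
  have hN : 0 < a.lcm b := Nat.lcm_pos ha hb
  obtain ⟨s, hs, hσ⟩ := endo_pow (a.lcm b) hN σ
  have hs1 : s ≡ 1 [MOD a.gcd b] := by
    apply modEq_of_fix _ (Nat.gcd_pos_of_pos_left _ ha)
    intro z hz
    rw [← hσ z, h1 z (root_mem_Qcyc hz)]
    obtain ⟨k, hk⟩ := (Nat.gcd_dvd_left a b).trans (Nat.dvd_lcm_left a b)
    rw [hk, pow_mul, hz, one_pow]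
  obtain ⟨t, ht1, ht2⟩ := Nat.chineseRemainder' hs1.symm
  have hta : t.Coprime a := by
    have := ht1.gcd_eq; rw [Nat.gcd_one_left] at this; exact this
  have htb : t.Coprime b := by
    have := ht2.gcd_eq
    unfold Nat.Coprime; rw [this]
    exact hs.coprime_dvd_right (Nat.dvd_lcm_right a b)
  obtain ⟨τ, hτ⟩ := endo_exists (a.lcm b) hN t ((hta.mul_right htb).coprime_dvd_right
    (Nat.lcm_dvd_mul a b))
  have pw : ∀ c : ℕ, c ∣ a.lcm b → ∀ z : ℂ, z ^ c = 1 → z ^ (a.lcm b) = 1 := by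
    rintro c ⟨k, hk⟩ z hz
    rw [hk, pow_mul, hz, one_pow]
  have e1 : τ x = x := endo_agree a τ (AlgHom.id ℚ ℂ) (fun z hz => by
    rw [hτ z (pw a (Nat.dvd_lcm_left a b) z hz), pow_eq_pow_mod t hz,
      show t % a = 1 % a from ht1, ← pow_eq_pow_mod 1 hz, pow_one]; rfl) x hxa
  have e2 : τ x = σ x := endo_agree b τ σ (fun z hz => by
    have := pw b (Nat.dvd_lcm_right a b) z hz
    rw [hτ z this, hσ z this, pow_eq_pow_mod t hz,
      show t % b = s % b from ht2, ← pow_eq_pow_mod s hz]) x hxb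
  exact h2 (e2.symm.trans e1)

lemma cyc_mem_zpowers {Γ : Type*} [Group Γ] [Finite Γ] [IsCyclic Γ] (p : ℕ) (hp : p.Prime)
    (σ τ : Γ) (hσ : orderOf σ = p) (hτ : τ ^ p = 1) : τ ∈ Subgroup.zpowers σ := by
  classical
  have := Fintype.ofFinite Γ
  have h1 := IsCyclic.card_pow_eq_one_le (α := Γ) hp.pos
  let S : Finset Γ := Finset.univ.filter (fun x => x ∈ Subgroup.zpowers σ)
  have hS : S.card = p := by
    rw [← hσ, ← Nat.card_zpowers, Nat.card_eq_fintype_card, Fintype.card_subtype]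
  have hsub : S ⊆ Finset.univ.filter (fun a : Γ => a ^ p = 1) := by
    intro x hx
    simp only [S, Finset.mem_filter, Finset.mem_univ, true_and] at hx ⊢
    obtain ⟨k, rfl⟩ := hx
    change (σ ^ k) ^ p = 1
    rw [← zpow_natCast, ← zpow_mul, mul_comm, zpow_mul, zpow_natCast, ← hσ, pow_orderOf_eq_one,
      one_zpow]
  have heq := Finset.eq_of_subset_of_card_le hsub (by rw [hS]; exact h1)
  have : τ ∈ S := by rw [heq]; simpa using hτ
  simpa [S] using this

lemma p_div_le {p a : ℕ} (hp : p.Prime) (hp2 : p ≠ 2) (ha : 2 ≤ a) (K : IntermediateField ℚ ℂ)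
    (hK : K ≤ Qcyc (p ^ a)) (hdvd : p ∣ K.relfinrank (Qcyc (p ^ a))) :
    K ≤ Qcyc (p ^ (a - 1)) := by
  have hpf : Fact p.Prime := ⟨hp⟩
  have : NeZero (p ^ a) := ⟨(pow_pos hp.pos a).ne'⟩
  intro y hy
  by_contra hcon
  obtain ⟨τ, h1, h2⟩ := gal_fixed (pow_dvd_pow p (Nat.sub_le a 1)) ⟨y, hK hy⟩ hcon
  let K' : IntermediateField ℚ (Qcyc (p ^ a)) := K.comap (Qcyc (p ^ a)).val
  have hfr : Module.finrank K' (Qcyc (p ^ a)) = K.relfinrank (Qcyc (p ^ a)) := by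
    have := IntermediateField.finrank_comap (A := K) (Qcyc (p ^ a)).val
    rwa [IntermediateField.fieldRange_val] at this
  rw [← hfr, ← IsGalois.card_fixingSubgroup_eq_finrank] at hdvd
  obtain ⟨⟨σ, hσK⟩, hσ⟩ := exists_prime_orderOf_dvd_card' p hdvd
  rw [Subgroup.orderOf_mk] at hσ
  let e := IsCyclotomicExtension.Rat.galEquivZMod (p ^ a) (Qcyc (p ^ a))
  have hcyc : IsCyclic (ZMod (p ^ a))ˣ := ZMod.isCyclic_units_of_prime_pow p hp hp2 a
  have hcyc' : IsCyclic Gal(Qcyc (p ^ a)/ℚ) := isCyclic_of_surjective e.symm e.symm.surjective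
  have hs : ((e τ : (ZMod (p ^ a))ˣ) : ZMod (p ^ a)).val ≡ 1 [MOD p ^ (a - 1)] := by
    apply modEq_of_fix _ (pow_pos hp.pos _)
    intro z hz
    have hz' : z ^ (p ^ a) = 1 := by
      rw [show a = (a - 1) + 1 by omega, pow_succ, pow_mul, hz, one_pow]
    have h3 := h1 ⟨z, root_mem_Qcyc hz'⟩ (root_mem_Qcyc hz)
    have h4 := IsCyclotomicExtension.Rat.galEquivZMod_apply_of_pow_eq (p ^ a) (Qcyc (p ^ a)) τ
      (x := ⟨z, root_mem_Qcyc hz'⟩) (by ext; simpa using hz')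
    rw [h3] at h4
    exact (congrArg Subtype.val h4).symm
  have hτ : τ ^ p = 1 := by
    apply e.injective
    rw [map_pow, map_one]
    ext
    rw [Units.val_pow_eq_pow_val, Units.val_one]
    set s := ((e τ : (ZMod (p ^ a))ˣ) : ZMod (p ^ a))
    have h5 : s.val ^ p ≡ 1 [MOD p ^ a] := by
      have h6 := (Nat.modEq_iff_dvd.1 hs.symm)
      push_cast at h6
      have h7 : ((p : ℤ) ^ a) ∣ ((s.val : ℤ) ^ p - 1 ^ p) := by
        obtain ⟨c, hc⟩ := h6
        have hs' : (s.val : ℤ) = 1 + p ^ (a - 1) * c := by linarith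
        rw [hs', one_pow]
        have hpp := (Commute.all (1 : ℤ) (p ^ (a - 1) * c)).exists_add_pow_prime_eq hp
        obtain ⟨r, hr⟩ := hpp
        rw [hr, one_pow]
        have d1 : ((p : ℤ) ^ a) ∣ ((p : ℤ) ^ (a - 1) * c) ^ p := by
          rw [mul_pow, ← pow_mul]
          apply Dvd.dvd.mul_right
          apply pow_dvd_pow
          have : 2 ≤ p := hp.two_le
          nlinarith [Nat.sub_add_cancel (show 1 ≤ a by omega), Nat.mul_le_mul_left (a - 1) this]
        have d2 : ((p : ℤ) ^ a) ∣ (p : ℤ) * 1 * (p ^ (a - 1) * c) * r := by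
          refine ⟨c * r, ?_⟩
          nth_rewrite 2 [show a = (a - 1) + 1 by omega]
          ring
        have := dvd_add d1 d2
        rw [add_assoc, add_sub_cancel_left]
        exact this
      apply (Nat.modEq_iff_dvd.2 _).symm
      push_cast
      simpa using h7
    have h8 := (ZMod.natCast_eq_natCast_iff _ _ _).2 h5
    simpa using h8
  have hmem := cyc_mem_zpowers p hp σ τ hσ hτ
  have hτK : τ ∈ K'.fixingSubgroup := (Subgroup.zpowers_le.2 hσK) hmem
  rw [IntermediateField.mem_fixingSubgroup_iff] at hτK
  exact h2 (hτK _ hy)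

lemma relfinrank_small {p a : ℕ} (hp : p.Prime) (ha : a ≤ 1) (K : IntermediateField ℚ ℂ) :
    ¬ p ∣ K.relfinrank (Qcyc (p ^ a)) := by
  have : NeZero (p ^ a) := ⟨(pow_pos hp.pos a).ne'⟩
  have h1 := IsCyclotomicExtension.Rat.finrank (p ^ a) (Qcyc (p ^ a))
  have h2 : K.relfinrank (Qcyc (p ^ a)) ∣ (p ^ a).totient := by
    rw [← h1]
    have := IntermediateField.finrank_comap (A := K) (Qcyc (p ^ a)).val
    rw [IntermediateField.fieldRange_val] at this
    rw [← this]
    exact ⟨Module.finrank ℚ (K.comap (Qcyc (p ^ a)).val), by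
      rw [mul_comm, Module.finrank_mul_finrank]⟩
  intro h
  have h3 := Nat.le_of_dvd (Nat.totient_pos.2 (pow_pos hp.pos _)) (h.trans h2)
  interval_cases a
  · simp at h3; exact absurd hp.two_le (by omega)
  · rw [pow_one, Nat.totient_prime hp] at h3
    have := hp.two_le
    omega

/-! ### Combinatorics -/

lemma exists_opp {ι : Type*} (S : Finset ι) (c : ι → ℤ) (hs : ∑ i ∈ S, c i = 0) (i : ι)
    (hi : i ∈ S) (hc : c i ≠ 0) : ∃ j ∈ S, c i * c j < 0 := by
  by_contra hcon
  push Not at hcon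
  have h1 : ∑ j ∈ S, c i * c j = 0 := by rw [← Finset.mul_sum, hs, mul_zero]
  have h2 := (Finset.sum_eq_zero_iff_of_nonneg hcon).1 h1 i hi
  exact hc (by simpa using h2)

lemma pow_eq_of_modEq {X : Type*} [Group X] {x : X} {N a b : ℕ} (hx : x ^ N = 1)
    (h : a ≡ b [MOD N]) : x ^ a = x ^ b := by
  rw [pow_eq_pow_mod a hx, pow_eq_pow_mod b hx, show a % N = b % N from h]

lemma comb {X : Type*} [CommGroup X] [Fintype X] [DecidableEq X] (p n m e s k : ℕ) (hp : p.Prime)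
    (hp2 : p ≠ 2) (hX : ∀ x : X, x ^ (p ^ n * m) = 1)
    (he0 : e ≡ 0 [MOD m]) (he1 : e ≡ 1 [MOD p ^ n])
    (hsm : s ≡ 1 [MOD m]) (hsp : s ≡ 1 [MOD p]) (hk : 0 < k) (hsk : s ^ k ≡ 1 [MOD p ^ n * m])
    (M : X → ℤ) (c : X → ℤ) (hinv : ∀ x, c x⁻¹ = c x) (hc : ∀ x, c (x ^ s) = M (x ^ s) - M x)
    (hP : ∀ μ, ∑ x with x ^ e = μ, c x = 0) (h4 : ∑ x, c x ^ 2 ≤ 4) : ∀ x, c x = 0 := by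
  by_contra hcon
  push Not at hcon
  obtain ⟨x, hx⟩ := hcon
  -- elements killed by `p ^ n` and prime-to-`p` power
  have hμ : ∀ y : X, ∀ j : ℕ, j.Coprime p → (y ^ e) ^ j = 1 → y ^ e = 1 := by
    intro y j hj h
    have h1 : (y ^ e) ^ (p ^ n) = 1 := by
      obtain ⟨r, hr⟩ := (Nat.modEq_zero_iff_dvd).1 he0
      rw [← pow_mul, hr, show m * r * p ^ n = p ^ n * m * r by ring, pow_mul, hX, one_pow]
    have h2 : orderOf (y ^ e) ∣ Nat.gcd j (p ^ n) :=
      Nat.dvd_gcd (orderOf_dvd_of_pow_eq_one h) (orderOf_dvd_of_pow_eq_one h1)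
    rw [(hj.pow_right n : Nat.gcd j (p ^ n) = 1), Nat.dvd_one] at h2
    exact orderOf_eq_one_iff.1 h2
  have hx1 : x ^ e ≠ 1 := by
    intro h
    have h3 : x ^ s = x := by
      -- order of `x` divides `m`
      have hord : x ^ m = 1 := by
        have : x ^ m = x ^ (m * e) := by
          apply pow_eq_of_modEq (hX x)
          have := (he1.mul_left' (c := m))
          rw [mul_one, mul_comm m (p ^ n)] at this
          exact this.symm
        rw [this, mul_comm, pow_mul, h, one_pow]
      have := pow_eq_of_modEq hord hsm
      rwa [pow_one] at this
    have h4 := hc x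
    rw [h3, sub_self] at h4
    exact hx h4
  obtain ⟨y, hyS, hy⟩ := exists_opp _ c (hP (x ^ e)) x (by simp) hx
  have hye : y ^ e = x ^ e := by simpa using hyS
  have hsum : ∑ i ∈ Finset.range k, c (x ^ (s ^ (i + 1))) = 0 := by
    have : ∀ i ∈ Finset.range k, c (x ^ (s ^ (i + 1))) =
        M (x ^ (s ^ (i + 1))) - M (x ^ (s ^ i)) := by
      intro i _
      rw [pow_succ, pow_mul, hc]
    rw [Finset.sum_congr rfl this, Finset.sum_range_sub (fun i => M (x ^ (s ^ i)))]
    rw [pow_eq_of_modEq (hX x) hsk]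
    simp
  have hxk : x ^ (s ^ (k - 1 + 1)) = x := by
    rw [Nat.sub_add_cancel hk, pow_eq_of_modEq (hX x) hsk, pow_one]
  obtain ⟨i, -, hi⟩ := exists_opp _ (fun i => c (x ^ (s ^ (i + 1)))) hsum (k - 1)
    (by simp; omega) (by simpa only [hxk] using hx)
  simp only [hxk] at hi
  set z := x ^ (s ^ (i + 1)) with hz
  -- facts about `z`
  have hsi : s ^ (i + 1) ≡ 1 [MOD m] := by simpa using hsm.pow (i + 1)
  have hsip : s ^ (i + 1) ≡ 1 [MOD p] := by simpa using hsp.pow (i + 1)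
  have neg_self : ¬ c x * c x < 0 := not_lt.2 (mul_self_nonneg _)
  have hcopr : (2 : ℕ).Coprime p := (Nat.coprime_primes Nat.prime_two hp).2 (Ne.symm hp2)
  have n1 : x ≠ x⁻¹ := by
    intro h
    apply hx1
    apply hμ x 2 hcopr
    have : x * x = 1 := by nth_rewrite 2 [h]; simp
    rw [← pow_mul, mul_comm, pow_mul, pow_two, this, one_pow]
  have n1' : x ^ e ≠ (x ^ e)⁻¹ := by
    intro h
    apply hx1
    apply hμ x 2 hcopr
    rw [pow_two]; nth_rewrite 2 [h]; simp
  have n2 : x ≠ y := by rintro rfl; exact neg_self hy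
  have n3 : x ≠ y⁻¹ := by
    intro h; apply n1'
    nth_rewrite 1 [h]; rw [inv_pow, hye]
  have n4 : x⁻¹ ≠ y := by
    intro h; apply n1'
    rw [← hye]; nth_rewrite 1 [← h]; rw [inv_pow, hye]
  have n5 : x⁻¹ ≠ y⁻¹ := fun h => n2 (inv_injective h)
  have n6 : y ≠ y⁻¹ := by
    intro h; apply n1'
    nth_rewrite 1 [← hye]; nth_rewrite 1 [h]; rw [inv_pow, hye]
  have z1 : x ≠ z := by intro h; rw [← h] at hi; exact neg_self hi
  have z2 : x⁻¹ ≠ z := by intro h; rw [← h, hinv] at hi; exact neg_self hi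
  have zy : y ≠ z := by
    intro h
    apply z1
    have h1 : z ^ e = x ^ e := by rw [← h, hye]
    have h3 : z ^ e = x ^ (s ^ (i + 1) * e) := by rw [hz, ← pow_mul]
    have h4 : x ^ (s ^ (i + 1) + e) = x ^ (1 + s ^ (i + 1) * e) := by
      apply pow_eq_of_modEq (hX x)
      apply Nat.modEq_iff_dvd.2
      have a1 := Nat.modEq_iff_dvd.1 hsi
      have a2 := Nat.modEq_iff_dvd.1 he1
      push_cast at a1 a2 ⊢
      have a3 := mul_dvd_mul a2 a1
      have : (1 + (s : ℤ) ^ (i + 1) * e - (s ^ (i + 1) + e)) =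
        (1 - (e : ℤ)) * (1 - (s : ℤ) ^ (i + 1)) := by ring
      rw [this]; exact a3
    rw [pow_add x (s ^ (i + 1)) e, pow_add x 1, ← h3, h1, pow_one, ← hz] at h4
    exact (mul_right_cancel h4).symm
  have zy' : y⁻¹ ≠ z := by
    intro h
    apply hx1
    apply hμ x (s ^ (i + 1) + 1)
    · have : s ^ (i + 1) + 1 ≡ 2 [MOD p] := hsip.add_right 1
      unfold Nat.Coprime
      rw [this.gcd_eq]; exact hcopr
    · have h1 : z ^ e = (x ^ e)⁻¹ := by rw [← h, inv_pow, hye]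
      rw [pow_succ, ← pow_mul, mul_comm e, pow_mul, ← hz, h1]; simp
  have hcy : c y ≠ 0 := by intro h; rw [h] at hy; simp at hy
  have hcz : c z ≠ 0 := by intro h; rw [h] at hi; simp at hi
  have hS : ∑ w ∈ ({x, x⁻¹, y, y⁻¹, z} : Finset X), c w ^ 2 ≤ 4 :=
    (Finset.sum_le_sum_of_subset_of_nonneg (Finset.subset_univ _)
      (fun w _ _ => sq_nonneg _)).trans h4
  rw [Finset.sum_insert (by simp [n1, n2, n3, z1]), Finset.sum_insert (by simp [n4, n2, z2]),
    Finset.sum_insert (by simp [n6, zy]), Finset.sum_insert (by simp [zy']),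
    Finset.sum_singleton, hinv, hinv] at hS
  have one_le : ∀ w : ℤ, w ≠ 0 → 1 ≤ w ^ 2 := fun w hw => by
    have := sq_pos_of_ne_zero hw
    omega
  have := one_le _ hx
  have := one_le _ hcy
  have := one_le _ hcz
  omega

/-! ### Representation theory -/

section RepT

open scoped ComplexConjugate Classical

/-- Multiplicity of a linear character in a class function. -/
noncomputable def mult {T : Type*} [CommGroup T] [Fintype T] (f : T → ℂ)
    (l : AddChar (Additive T) ℂ) : ℂ :=
  (Nat.card T : ℂ)⁻¹ * ∑ t : T, f t * l (-(Additive.ofMul t))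

variable {T : Type*} [CommGroup T] [Fintype T]

lemma mult_inversion (f : T → ℂ) (t : T) :
    f t = ∑ l : AddChar (Additive T) ℂ, mult f l * l (Additive.ofMul t) := by
  unfold mult
  have h : ∀ l : AddChar (Additive T) ℂ,
      (Nat.card T : ℂ)⁻¹ * (∑ u : T, f u * l (-(Additive.ofMul u))) * l (Additive.ofMul t) =
      (Nat.card T : ℂ)⁻¹ * ∑ u : T, f u * l (Additive.ofMul t - Additive.ofMul u) := by
    intro l
    rw [mul_assoc, Finset.sum_mul]
    congr 1
    apply Finset.sum_congr rfl
    intro u _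
    rw [mul_assoc, ← AddChar.map_add_eq_mul, neg_add_eq_sub]
  simp_rw [h]
  rw [← Finset.mul_sum, Finset.sum_comm]
  simp_rw [← Finset.mul_sum, AddChar.sum_apply_eq_ite]
  have h2 : ∀ u : T, (Additive.ofMul t - Additive.ofMul u = 0) ↔ u = t := by
    intro u
    rw [sub_eq_zero]
    exact ⟨fun h => (Additive.ofMul.injective h).symm, fun h => by rw [h]⟩
  simp_rw [h2]
  have h3 : (Nat.card T : ℂ) ≠ 0 := by simp
  simp
  field_simp

lemma mult_nat {W : Type*} [AddCommGroup W] [Module ℂ W] [FiniteDimensional ℂ W]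
    (ρ : Representation ℂ T W) (l : AddChar (Additive T) ℂ) :
    ∃ n : ℕ, mult ρ.character l = n := by
  let ρ' : Representation ℂ T W :=
    { toFun := fun t => l (-(Additive.ofMul t)) • ρ t
      map_one' := by simp
      map_mul' := by
        intro a b
        rw [ofMul_mul, neg_add, AddChar.map_add_eq_mul, map_mul, smul_mul_smul_comm] }
  have h3 : (Nat.card T : ℂ) ≠ 0 := by simp
  have : Invertible (Nat.card T : ℂ) := invertibleOfNonzero h3
  refine ⟨Module.finrank ℂ ρ'.invariants, ?_⟩
  unfold mult
  rw [← ρ'.card_inv_mul_sum_char_eq_finrank]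
  congr 1
  apply Finset.sum_congr rfl
  intro t _
  simp [Representation.character, ρ', mul_comm]

lemma mult_inv (f : T → ℂ) (l : AddChar (Additive T) ℂ) :
    mult f l⁻¹ = mult (fun t => f t⁻¹) l := by
  unfold mult
  congr 1
  rw [← Equiv.sum_comp (Equiv.inv T)]
  apply Finset.sum_congr rfl
  intro t _
  simp [AddChar.inv_apply]

lemma mult_sub (f g : T → ℂ) (l : AddChar (Additive T) ℂ) :
    mult (fun t => f t - g t) l = mult f l - mult g l := by
  unfold mult
  rw [← mul_sub, ← Finset.sum_sub_distrib]
  simp_rw [sub_mul]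

lemma parseval (f : T → ℂ) :
    ∑ l : AddChar (Additive T) ℂ, mult f l * mult f l =
      (Nat.card T : ℂ)⁻¹ * ∑ t : T, f t * f t⁻¹ := by
  have h : ∀ l : AddChar (Additive T) ℂ, mult f l * mult f l =
      (Nat.card T : ℂ)⁻¹ * ∑ t : T, f t⁻¹ * (mult f l * l (Additive.ofMul t)) := by
    intro l
    nth_rewrite 2 [← inv_inv l]
    rw [mult_inv]
    nth_rewrite 2 [mult]
    rw [mul_left_comm, Finset.mul_sum]
    congr 1
    apply Finset.sum_congr rfl
    intro t _
    rw [AddChar.inv_apply, neg_neg]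
    ring
  simp_rw [h]
  rw [← Finset.mul_sum, Finset.sum_comm]
  congr 1
  apply Finset.sum_congr rfl
  intro t _
  rw [← Finset.mul_sum, ← mult_inversion, mul_comm]

lemma fourier_unique (c : AddChar (Additive T) ℂ → ℂ)
    (h : ∀ t : T, ∑ l, c l * l (Additive.ofMul t) = 0) : ∀ l, c l = 0 := by
  have h1 := AddChar.linearIndependent (Additive T) ℂ
  rw [Fintype.linearIndependent_iff] at h1
  intro l
  apply h1 c
  funext t
  have := h (Additive.toMul t)
  simpa using this

end RepT

section RepG

open scoped ComplexConjugate Classical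

variable {G : Type*} [Group G] [Fintype G] {W : Type*} [AddCommGroup W] [Module ℂ W]
  [FiniteDimensional ℂ W]

lemma char_inv_eq_conj (ρ : Representation ℂ G W) (g : G) :
    ρ.character g⁻¹ = conj (ρ.character g) := by
  let T := Subgroup.zpowers g
  let _ : CommGroup T := { (inferInstance : Group T) with
    mul_comm := by
      rintro ⟨_, i, rfl⟩ ⟨_, j, rfl⟩
      exact Subtype.ext (zpow_mul_comm g i j) }
  let t : T := ⟨g, Subgroup.mem_zpowers g⟩
  let ρ' : Representation ℂ T W := ρ.comp T.subtype
  have h1 : ρ.character g = ρ'.character t := rfl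
  have h2 : ρ.character g⁻¹ = ρ'.character t⁻¹ := rfl
  rw [h1, h2, mult_inversion ρ'.character, mult_inversion ρ'.character t, map_sum]
  apply Finset.sum_congr rfl
  intro l _
  obtain ⟨n, hn⟩ := mult_nat ρ' l
  rw [hn, map_mul, map_natCast, ofMul_inv, AddChar.map_neg_eq_conj]

lemma char_mem_Qcyc (ρ : Representation ℂ G W) (g : G) (k : ℕ) (hk : g ^ k = 1) :
    ρ.character g ∈ Qcyc k := by
  let T := Subgroup.zpowers g
  let _ : CommGroup T := { (inferInstance : Group T) with
    mul_comm := by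
      rintro ⟨_, i, rfl⟩ ⟨_, j, rfl⟩
      exact Subtype.ext (zpow_mul_comm g i j) }
  let t : T := ⟨g, Subgroup.mem_zpowers g⟩
  let ρ' : Representation ℂ T W := ρ.comp T.subtype
  have h1 : ρ.character g = ρ'.character t := rfl
  rw [h1, mult_inversion ρ'.character]
  apply sum_mem
  intro l _
  obtain ⟨n, hn⟩ := mult_nat ρ' l
  rw [hn]
  apply mul_mem (natCast_mem _ n)
  apply IntermediateField.subset_adjoin
  show _ ^ k = 1
  have ht : t ^ k = 1 := Subtype.ext hk
  rw [← AddChar.map_nsmul_eq_pow, ← ofMul_pow, ht, ofMul_one, AddChar.map_zero_eq_one]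

/-- Galois twist of a representation. -/
lemma exists_twist (ρ : Representation ℂ G W) (σ : ℂ →ₐ[ℚ] ℂ) :
    ∃ ρ' : Representation ℂ G (Fin (Module.finrank ℂ W) → ℂ),
      ∀ g, ρ'.character g = σ (ρ.character g) := by
  let b := Module.finBasis ℂ W
  let ρ' : Representation ℂ G (Fin (Module.finrank ℂ W) → ℂ) :=
    { toFun := fun g => Matrix.toLin' ((LinearMap.toMatrix b b (ρ g)).map (σ : ℂ →+* ℂ))
      map_one' := by
        rw [map_one, LinearMap.toMatrix_one, Matrix.map_one _ (map_zero _) (map_one _),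
          Matrix.toLin'_one]
        rfl
      map_mul' := by
        intro x y
        rw [map_mul, LinearMap.toMatrix_mul, Matrix.map_mul, Matrix.toLin'_mul]
        rfl }
  refine ⟨ρ', fun g => ?_⟩
  unfold Representation.character
  rw [LinearMap.trace_eq_matrix_trace ℂ b (ρ g)]
  have h1 : ρ' g = Matrix.toLin' ((LinearMap.toMatrix b b (ρ g)).map (σ : ℂ →+* ℂ)) := rfl
  rw [h1, Matrix.trace_toLin'_eq]
  simp [Matrix.trace]

/-- The norm of the difference of an irreducible character and a Galois conjugate. -/
lemma norm_diff_le (ρ : Representation ℂ G W) (σ : ℂ →ₐ[ℚ] ℂ)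
    (h1 : (Nat.card G : ℂ)⁻¹ * ∑ g : G, ρ.character g * ρ.character g⁻¹ = 1) :
    ∑ g : G, ‖ρ.character g - σ (ρ.character g)‖ ^ 2 ≤ 2 * Nat.card G := by
  obtain ⟨ρ', hρ'⟩ := exists_twist ρ σ
  have h3 : (Nat.card G : ℂ) ≠ 0 := by simp
  have : Invertible (Nat.card G : ℂ) := invertibleOfNonzero h3
  have e1 := Representation.card_inv_mul_sum_char_mul_char_eq_finrank ρ ρ'
  have e2 := Representation.card_inv_mul_sum_char_mul_char_eq_finrank ρ' ρ
  have e3 : (Nat.card G : ℂ)⁻¹ * ∑ g : G, ρ'.character g * ρ'.character g⁻¹ = 1 := by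
    have := congrArg σ h1
    rw [map_mul, map_inv₀, map_natCast, map_one, map_sum] at this
    rw [← this]
    simp_rw [hρ', map_mul]
  have e4 : ((∑ g : G, ‖ρ.character g - σ (ρ.character g)‖ ^ 2 : ℝ) : ℂ) =
      Nat.card G * (2 - (Module.finrank ℂ (ρ.IntertwiningMap ρ') : ℂ) -
        Module.finrank ℂ (ρ'.IntertwiningMap ρ)) := by
    rw [← e1, ← e2, show (2 : ℂ) = 1 + 1 by norm_num]
    nth_rewrite 1 [← h1]
    rw [← e3, ← mul_add, ← mul_sub, ← mul_sub, mul_inv_cancel_left₀ h3,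
      ← Finset.sum_add_distrib, ← Finset.sum_sub_distrib, ← Finset.sum_sub_distrib]
    push_cast
    apply Finset.sum_congr rfl
    intro g _
    rw [← Complex.mul_conj', map_sub, ← hρ', ← char_inv_eq_conj, ← char_inv_eq_conj]
    ring
  have e5 : (∑ g : G, ‖ρ.character g - σ (ρ.character g)‖ ^ 2 : ℝ) =
      Nat.card G * (2 - (Module.finrank ℂ (ρ.IntertwiningMap ρ') : ℝ) -
        Module.finrank ℂ (ρ'.IntertwiningMap ρ)) := by
    exact_mod_cast e4
  rw [e5, mul_comm]
  gcongr
  have : (0 : ℝ) ≤ (Module.finrank ℂ (ρ.IntertwiningMap ρ') : ℝ) := by positivity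
  have : (0 : ℝ) ≤ (Module.finrank ℂ (ρ'.IntertwiningMap ρ) : ℝ) := by positivity
  linarith

/-- Comparison of norms on a subgroup. -/
lemma sub_norm_le {T : Type*} [Group T] [Fintype T] (ι : T →* G) (hι : Function.Injective ι)
    (f : G → ℝ) (hf : ∀ g, 0 ≤ f g) (hcl : ∀ g y, f (y * g * y⁻¹) = f g)
    (hn : ∀ g, f g ≠ 0 → Nat.card {y : G // y⁻¹ * g * y ∈ ι.range} ≤ 2 * Nat.card T)
    (hs : ∑ g, f g ≤ 2 * Nat.card G) : ∑ t, f (ι t) ≤ 4 * Nat.card T := by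
  have e1 : ∑ y : G, ∑ x : G, (if y⁻¹ * x * y ∈ ι.range then f x else 0) =
      Nat.card G * ∑ t, f (ι t) := by
    have : ∀ y : G, ∑ x : G, (if y⁻¹ * x * y ∈ ι.range then f x else 0) = ∑ t, f (ι t) := by
      intro y
      rw [← Equiv.sum_comp (MulAut.conj y).toEquiv]
      have h2 : ∀ x : G, (if y⁻¹ * ((MulAut.conj y).toEquiv x) * y ∈ ι.range then
          f ((MulAut.conj y).toEquiv x) else 0) = if x ∈ ι.range then f x else 0 := by
        intro x
        have : (MulAut.conj y).toEquiv x = y * x * y⁻¹ := rfl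
        rw [this, hcl]
        congr 2
        group
      simp_rw [h2]
      rw [← Finset.sum_filter]
      have h4 : (Finset.univ.filter (fun x => x ∈ ι.range)) = Finset.univ.image ι := by
        ext x; simp
      rw [h4, Finset.sum_image (fun a _ b _ h => hι h)]
    simp_rw [this]
    simp
  have e2 : ∑ y : G, ∑ x : G, (if y⁻¹ * x * y ∈ ι.range then f x else 0) ≤
      ∑ x : G, (2 * Nat.card T) * f x := by
    rw [Finset.sum_comm]
    apply Finset.sum_le_sum
    intro x _
    rw [← Finset.sum_filter, Finset.sum_const, nsmul_eq_mul]
    by_cases h0 : f x = 0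
    · simp [h0]
    · have := hn x h0
      rw [Nat.card_eq_fintype_card, Fintype.card_subtype] at this
      apply mul_le_mul_of_nonneg_right _ (hf x)
      exact_mod_cast this
  rw [e1, ← Finset.mul_sum] at e2
  have h3 : (0 : ℝ) < Nat.card G := by exact_mod_cast Nat.card_pos
  have h4 : (Nat.card G : ℝ) * ∑ t, f (ι t) ≤ Nat.card G * (4 * Nat.card T) := by
    refine e2.trans ?_
    have := mul_le_mul_of_nonneg_left hs (by positivity : (0 : ℝ) ≤ 2 * Nat.card T)
    linarith
  exact le_of_mul_le_mul_left h4 h3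

end RepG

section RepR

open scoped ComplexConjugate Classical

theorem thmR {G : Type*} [Group G] [Fintype G] {W : Type*} [AddCommGroup W] [Module ℂ W]
    [FiniteDimensional ℂ W] (ρ : Representation ℂ G W)
    (hirr : (Nat.card G : ℂ)⁻¹ * ∑ g : G, ρ.character g * ρ.character g⁻¹ = 1)
    {T : Type*} [CommGroup T] [Fintype T] (ι : T →* G) (hι : Function.Injective ι)
    (σ : ℂ →ₐ[ℚ] ℂ) (p n m s : ℕ) (hp : p.Prime) (hp2 : p ≠ 2) (hm : 0 < m)
    (hpm : p.Coprime m)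
    (hN : ∀ g : G, g ^ (p ^ n * m) = 1) (hsN : s.Coprime (p ^ n * m))
    (hsm : s ≡ 1 [MOD m]) (hsp : s ≡ 1 [MOD p])
    (hσ : ∀ z : ℂ, z ^ (p ^ n * m) = 1 → σ z = z ^ s)
    (w : G) (hw : ∀ t, w * ι t * w⁻¹ = (ι t)⁻¹)
    (hψ1 : ∀ g : G, g ^ (p ^ n) = 1 → σ (ρ.character g) = ρ.character g)
    (hn : ∀ g : G, ρ.character g - σ (ρ.character g) ≠ 0 →
      Nat.card {y : G // y⁻¹ * g * y ∈ ι.range} ≤ 2 * Nat.card T) :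
    ∀ t, σ (ρ.character (ι t)) = ρ.character (ι t) := by
  obtain ⟨ρ', hρ'⟩ := exists_twist ρ σ
  have hT : ∀ t : T, t ^ (p ^ n * m) = 1 := fun t => hι (by rw [map_pow, hN, map_one])
  let ρ1 : Representation ℂ T W := ρ.comp ι
  let ρ2 : Representation ℂ T (Fin (Module.finrank ℂ W) → ℂ) := ρ'.comp ι
  have h1 : ∀ t, ρ1.character t = ρ.character (ι t) := fun t => rfl
  have h2 : ∀ t, ρ2.character t = σ (ρ.character (ι t)) := fun t => hρ' (ι t)
  choose M hM using mult_nat ρ1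
  choose M' hM' using mult_nat ρ2
  have hl : ∀ (l : AddChar (Additive T) ℂ) (t : Additive T), (l t) ^ (p ^ n * m) = 1 := by
    intro l t
    rw [← AddChar.map_nsmul_eq_pow]
    have := hT (Additive.toMul t)
    have h3 : (p ^ n * m) • t = 0 := this
    rw [h3, AddChar.map_zero_eq_one]
  have hinv1 : ∀ g : G, ∀ t, g = ι t → ρ.character g⁻¹ = ρ.character g := by
    rintro _ t rfl
    rw [← hw, Representation.char_conj]
  have hinvM : ∀ l, M l⁻¹ = M l := by
    intro l
    have : (M l⁻¹ : ℂ) = M l := by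
      rw [← hM, ← hM, mult_inv]
      congr 1
      funext t
      rw [h1, h1, map_inv, hinv1 _ t rfl]
    exact_mod_cast this
  have hinvM' : ∀ l, M' l⁻¹ = M' l := by
    intro l
    have : (M' l⁻¹ : ℂ) = M' l := by
      rw [← hM', ← hM', mult_inv]
      congr 1
      funext t
      rw [h2, h2, map_inv, hinv1 _ t rfl]
    exact_mod_cast this
  have hMs : ∀ l, M' (l ^ s) = M l := by
    intro l
    have : (M' (l ^ s) : ℂ) = M l := by
      rw [← hM', ← map_natCast σ (M l), ← hM]
      unfold mult
      rw [map_mul, map_inv₀, map_natCast, map_sum]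
      congr 1
      apply Finset.sum_congr rfl
      intro t _
      rw [h2, map_mul, h1, hσ _ (hl _ _), AddChar.pow_apply]
    exact_mod_cast this
  let c : AddChar (Additive T) ℂ → ℤ := fun l => M l - M' l
  have hcψ : ∀ t, ρ.character (ι t) - σ (ρ.character (ι t)) =
      ∑ l, (c l : ℂ) * l (Additive.ofMul t) := by
    intro t
    rw [← h2, ← h1, mult_inversion ρ1.character, mult_inversion ρ2.character,
      ← Finset.sum_sub_distrib]
    apply Finset.sum_congr rfl
    intro l _
    rw [hM, hM', ← sub_mul]
    simp [c]
  have hcm : ∀ l, mult (fun t => ρ.character (ι t) - σ (ρ.character (ι t))) l = c l := by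
    intro l
    have : (fun t => ρ.character (ι t) - σ (ρ.character (ι t))) =
      fun t => ρ1.character t - ρ2.character t := by
        funext t; rw [h1, h2]
    rw [this, mult_sub, hM, hM']
    simp [c]
  obtain ⟨e, he0, he1⟩ := Nat.chineseRemainder (Nat.Coprime.pow_right n hpm.symm) 0 1
  have key := comb (X := AddChar (Additive T) ℂ) p n m e s (Nat.totient (p ^ n * m)) hp hp2
    (by
      intro x
      ext t
      rw [AddChar.pow_apply, hl, AddChar.one_apply]) he0 he1 hsm hsp
    (Nat.totient_pos.2 (Nat.mul_pos (pow_pos hp.pos n) hm)) (Nat.ModEq.pow_totient hsN)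
    (fun l => (M l : ℤ)) c (by intro x; simp only [c, hinvM, hinvM'])
    (by intro x; simp only [c, hMs])
    (by
      have h5 := fourier_unique (T := T) (fun μ => ((∑ x with x ^ e = μ, c x : ℤ) : ℂ)) (by
        intro t
        have h6 : ρ.character (ι (t ^ e)) - σ (ρ.character (ι (t ^ e))) = 0 := by
          rw [hψ1, sub_self]
          obtain ⟨r, hr⟩ := (Nat.modEq_zero_iff_dvd).1 he0
          rw [← map_pow, ← pow_mul, hr, show m * r * p ^ n = p ^ n * m * r by ring, pow_mul, hT,
            one_pow, map_one]
        rw [hcψ] at h6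
        rw [← h6]
        rw [← Finset.sum_fiberwise (g := fun x : AddChar (Additive T) ℂ => x ^ e)
          (f := fun l => (c l : ℂ) * l (Additive.ofMul (t ^ e)))]
        apply Finset.sum_congr rfl
        intro μ _
        push_cast
        rw [Finset.sum_mul]
        apply Finset.sum_congr rfl
        intro x hx
        have : x ^ e = μ := by simpa using hx
        rw [← this, AddChar.pow_apply, ofMul_pow, AddChar.map_nsmul_eq_pow])
      intro μ
      exact_mod_cast h5 μ)
    (by
      have h5 := parseval (fun t => ρ.character (ι t) - σ (ρ.character (ι t)))
      simp_rw [hcm] at h5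
      have h6 : ∑ t : T, (ρ.character (ι t) - σ (ρ.character (ι t))) *
          (ρ.character (ι t⁻¹) - σ (ρ.character (ι t⁻¹))) =
          ((∑ t : T, ‖ρ.character (ι t) - σ (ρ.character (ι t))‖ ^ 2 : ℝ) : ℂ) := by
        push_cast
        apply Finset.sum_congr rfl
        intro t _
        rw [← Complex.mul_conj', map_sub, ← hρ', ← hρ', map_inv, char_inv_eq_conj,
          char_inv_eq_conj]
      rw [h6] at h5
      have h7 := sub_norm_le ι hι (fun g => ‖ρ.character g - σ (ρ.character g)‖ ^ 2)
        (fun g => by positivity) (fun g y => by simp only [Representation.char_conj])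
        (fun g hg => hn g (by simpa using hg)) (norm_diff_le ρ σ hirr)
      have h8 : (∑ l, c l * c l : ℝ) = (Nat.card T : ℝ)⁻¹ *
        ∑ t : T, ‖ρ.character (ι t) - σ (ρ.character (ι t))‖ ^ 2 := by
          apply Complex.ofReal_injective
          push_cast at h5 ⊢
          exact h5
      have h9 : (∑ l, c l * c l : ℝ) ≤ 4 := by
        rw [h8]
        have h3 : (0 : ℝ) < Nat.card T := by exact_mod_cast Nat.card_pos
        rw [inv_mul_le_iff₀ h3]
        linarith
      have h10 : ∑ l, c l * c l ≤ 4 := by exact_mod_cast h9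
      simpa only [pow_two] using h10)
  intro t
  have := hcψ t
  simp only [key, Int.cast_zero, zero_mul, Finset.sum_const_zero] at this
  exact (sub_eq_zero.1 this).symm

end RepR

/-! ### The group `SL₂` -/

section SL2

open Matrix

variable {F : Type*} [Field F]

lemma lin_of_comm (A B : Matrix (Fin 2) (Fin 2) F)
    (hA : A.trace ^ 2 ≠ 4) (hd : A.det = 1) (hAB : A * B = B * A) :
    ∃ α β : F, B = α • 1 + β • A := by
  rw [Matrix.det_fin_two] at hd
  rw [Matrix.trace_fin_two] at hA
  have e00 := congrFun (congrFun hAB 0) 0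
  have e01 := congrFun (congrFun hAB 0) 1
  have e10 := congrFun (congrFun hAB 1) 0
  simp only [Matrix.mul_apply, Fin.sum_univ_two] at e00 e01 e10
  by_cases hb : A 0 1 = 0
  · by_cases hc : A 1 0 = 0
    · have had : A 0 0 - A 1 1 ≠ 0 := by
        intro h
        apply hA
        have h' : A 0 0 = A 1 1 := sub_eq_zero.1 h
        rw [hb] at hd
        rw [h'] at hd ⊢
        linear_combination 4 * hd
      have hf : B 0 1 = 0 := by
        have : (A 0 0 - A 1 1) * B 0 1 = 0 := by rw [hb] at e01; linear_combination e01
        exact (mul_eq_zero.1 this).resolve_left had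
      have hg : B 1 0 = 0 := by
        have : (A 0 0 - A 1 1) * B 1 0 = 0 := by rw [hc] at e10; linear_combination -e10
        exact (mul_eq_zero.1 this).resolve_left had
      refine ⟨B 0 0 - (B 0 0 - B 1 1) / (A 0 0 - A 1 1) * A 0 0,
        (B 0 0 - B 1 1) / (A 0 0 - A 1 1), ?_⟩
      ext i j
      fin_cases i <;> fin_cases j <;> simp [hb, hc, hf, hg]
      field_simp
      ring
    · refine ⟨B 0 0 - B 1 0 / A 1 0 * A 0 0, B 1 0 / A 1 0, ?_⟩
      ext i j
      fin_cases i <;> fin_cases j <;> simp [hb, hc]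
      · have : B 0 1 * A 1 0 = 0 := by linear_combination -e00 + hb * B 1 0
        exact (mul_eq_zero.1 this).resolve_right hc
      · field_simp
        linear_combination -e10
  · refine ⟨B 0 0 - B 0 1 / A 0 1 * A 0 0, B 0 1 / A 0 1, ?_⟩
    ext i j
    fin_cases i <;> fin_cases j <;> simp [hb]
    · field_simp
      linear_combination e00
    · field_simp
      linear_combination e01

lemma eq_or_eq_inv (A B : Matrix (Fin 2) (Fin 2) F)
    (hA : A.trace ^ 2 ≠ 4) (hd : A.det = 1) (hd' : B.det = 1) (ht : B.trace = A.trace)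
    (hAB : A * B = B * A) : B = A ∨ B = A.trace • 1 - A := by
  obtain ⟨α, β, rfl⟩ := lin_of_comm A B hA hd hAB
  rw [Matrix.det_fin_two] at hd hd'
  rw [Matrix.trace_fin_two] at hA ht
  rw [Matrix.trace_fin_two] at ht ⊢
  simp at hd' ht
  set τ := A 0 0 + A 1 1 with hτ
  have ht1 : 2 * α = τ * (1 - β) := by linear_combination ht
  have hd1 : α ^ 2 + α * β * τ + β ^ 2 = 1 := by
    linear_combination hd' + α * β * hτ - β ^ 2 * hd
  have h1 : (τ ^ 2 - 4) * ((1 - β) * (1 + β)) = 0 := by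
    linear_combination 4 * hd1 - (2 * α + τ * (1 - β) + 2 * β * τ) * ht1
  have h2 := (mul_eq_zero.1 h1).resolve_left (sub_ne_zero.2 hA)
  have key : (α = 0 ∧ β = 1) ∨ (α = τ ∧ β = -1) := by
    rcases mul_eq_zero.1 h2 with h | h
    · have hβ : β = 1 := by linear_combination -h
      subst hβ
      have h3 : α * (α + τ) = 0 := by linear_combination hd1
      have h4 : (2 : F) * α = 0 := by linear_combination ht1
      rcases mul_eq_zero.1 h3 with h5 | h5
      · exact Or.inl ⟨h5, rfl⟩
      · rcases mul_eq_zero.1 h4 with h6 | h6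
        · exact Or.inr ⟨by linear_combination h5 - τ * h6, by linear_combination h6⟩
        · exact Or.inl ⟨h6, rfl⟩
    · have hβ : β = -1 := by linear_combination h
      subst hβ
      have h3 : α * (α - τ) = 0 := by linear_combination hd1
      have h4 : (2 : F) * (α - τ) = 0 := by linear_combination ht1
      rcases mul_eq_zero.1 h4 with h6 | h6
      · rcases mul_eq_zero.1 h3 with h5 | h5
        · exact Or.inl ⟨h5, by linear_combination -h6⟩
        · exact Or.inr ⟨by linear_combination h5, rfl⟩
      · exact Or.inr ⟨by linear_combination h6, rfl⟩
  rcases key with ⟨rfl, rfl⟩ | ⟨h, rfl⟩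
  · left; simp
  · right; rw [h]; simp [sub_eq_add_neg]

lemma quad_rep [Fintype F] (P Q : F) (h : P ^ 2 ≠ 4 * Q) :
    ∃ x u : F, x ^ 2 + P * x * u + Q * u ^ 2 = -1 := by
  classical
  by_cases h2 : (2 : F) = 0
  · exact ⟨1, 0, by linear_combination h2⟩
  · have hc : ringChar F ≠ 2 := by
      intro h
      apply h2
      have := ringChar.Nat.cast_ringChar (R := F)
      rw [h] at this
      exact_mod_cast this
    have h4 : (4 : F) ≠ 0 := by
      rw [show (4 : F) = 2 * 2 by norm_num]; exact mul_ne_zero h2 h2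
    have hD : Q - P ^ 2 / 4 ≠ 0 := by
      intro h'
      apply h
      field_simp at h'
      linear_combination -h'
    obtain ⟨a, b, hab⟩ := FiniteField.exists_root_sum_quadratic
      (f := Polynomial.X ^ 2 + Polynomial.C 1)
      (g := Polynomial.C (Q - P ^ 2 / 4) * Polynomial.X ^ 2)
      (by compute_degree!) (by compute_degree!)
      (FiniteField.odd_card_of_char_ne_two hc)
    refine ⟨a - P / 2 * b, b, ?_⟩
    simp at hab
    field_simp at hab ⊢
    linear_combination hab

lemma exists_w [Fintype F] (A : Matrix (Fin 2) (Fin 2) F)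
    (hA : A.trace ^ 2 ≠ 4) (hd : A.det = 1) :
    ∃ x y u : F, x ^ 2 + y * u = -1 ∧ x * (A 0 0 - A 1 1) + y * A 1 0 + u * A 0 1 = 0 := by
  rw [Matrix.det_fin_two] at hd
  rw [Matrix.trace_fin_two] at hA
  by_cases hc : A 1 0 = 0
  · by_cases hb : A 0 1 = 0
    · exact ⟨0, 1, -1, by ring, by rw [hc, hb]; ring⟩
    · obtain ⟨x, y, h⟩ := quad_rep (-(A 0 0 - A 1 1) / A 0 1) (-A 1 0 / A 0 1) (by
        intro h
        field_simp at h
        apply hA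
        linear_combination h + 4 * hd)
      refine ⟨x, y, -(x * (A 0 0 - A 1 1) + y * A 1 0) / A 0 1, ?_, ?_⟩
      · rw [← h]; field_simp; ring
      · field_simp; ring
  · obtain ⟨x, u, h⟩ := quad_rep (-(A 0 0 - A 1 1) / A 1 0) (-A 0 1 / A 1 0) (by
      intro h
      field_simp at h
      apply hA
      linear_combination h + 4 * hd)
    refine ⟨x, -(x * (A 0 0 - A 1 1) + u * A 0 1) / A 1 0, u, ?_, ?_⟩
    · rw [← h]; field_simp; ring
    · field_simp; ring

lemma ch_two (A : Matrix (Fin 2) (Fin 2) F) (hd : A.det = 1) :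
    A * A = A.trace • A - 1 := by
  rw [Matrix.det_fin_two] at hd
  rw [Matrix.trace_fin_two]
  ext i j
  fin_cases i <;> fin_cases j <;> simp [Matrix.mul_apply, Fin.sum_univ_two]
  · linear_combination -hd
  · ring
  · ring
  · linear_combination -hd

lemma pow_two_char (r : ℕ) (hr : r.Prime) [CharP F r] (A : Matrix (Fin 2) (Fin 2) F)
    (hA : A.trace ^ 2 = 4) (hd : A.det = 1) : A ^ (2 * r) = 1 := by
  have : Fact r.Prime := ⟨hr⟩
  have h1 : (A * A - 1) ^ 2 = 0 := by
    have h2 := ch_two A hd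
    have h3 : A * A - 1 = A.trace • A - (2 : F) • 1 := by
      rw [h2, two_smul]; abel
    rw [h3, pow_two, sub_mul, mul_sub, mul_sub]
    simp only [smul_mul_assoc, mul_smul_comm, h2, mul_one, one_mul, smul_sub, smul_smul]
    rw [← pow_two, hA]
    have : A.trace * 4 = A.trace ^ 3 := by rw [pow_succ, hA, mul_comm]
    module
  have h2 : (A * A - 1) ^ r = 0 := pow_eq_zero_of_le hr.two_le h1
  have h3 : A * A = (A * A - 1) + 1 := by abel
  rw [pow_mul, pow_two, h3, add_pow_char_of_commute _ (Commute.one_right _), h2, one_pow, zero_add]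

end SL2

section SL2G

open Matrix

lemma card_le_aux {G : Type*} [Group G] [Finite G] (T : Subgroup G) (g w : G)
    (h : ∀ y, y⁻¹ * g * y ∈ T → ∀ z, (y * z)⁻¹ * g * (y * z) ∈ T → z ∈ T ∨ z * w ∈ T) :
    Nat.card {y : G // y⁻¹ * g * y ∈ T} ≤ 2 * Nat.card T := by
  by_cases hne : ∃ y, y⁻¹ * g * y ∈ T
  · obtain ⟨y₀, hy₀⟩ := hne
    let f : T ⊕ T → G := Sum.elim (fun t => y₀ * t) (fun t => y₀ * (t * w⁻¹))
    have h1 : {y : G | y⁻¹ * g * y ∈ T} ⊆ Set.range f := by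
      intro y hy
      have hy' : (y₀ * (y₀⁻¹ * y))⁻¹ * g * (y₀ * (y₀⁻¹ * y)) ∈ T := by
        rw [mul_inv_cancel_left]; exact hy
      rcases h y₀ hy₀ _ hy' with h2 | h2
      · exact ⟨Sum.inl ⟨_, h2⟩, by simp [f]⟩
      · exact ⟨Sum.inr ⟨_, h2⟩, by simp [f]⟩
    have h2 := Set.ncard_le_ncard h1 (Set.toFinite _)
    have h3 : (Set.range f).ncard ≤ Nat.card (T ⊕ T) := by
      rw [← Nat.card_coe_set_eq]
      exact Finite.card_range_le f
    rw [Nat.card_sum] at h3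
    rw [← Nat.card_coe_set_eq] at h2
    have h4 : Nat.card {y : G // y⁻¹ * g * y ∈ T} ≤ _ := h2
    omega
  · push Not at hne
    have : IsEmpty {y : G // y⁻¹ * g * y ∈ T} := ⟨fun y => hne y.1 y.2⟩
    simp

variable {F : Type*} [Field F]

lemma sl_comm_iff (x y : Matrix.SpecialLinearGroup (Fin 2) F) :
    x * y = y * x ↔ (x : Matrix (Fin 2) (Fin 2) F) * y = (y : Matrix (Fin 2) (Fin 2) F) * x := by
  constructor
  · intro h
    rw [← Matrix.SpecialLinearGroup.coe_mul, h, Matrix.SpecialLinearGroup.coe_mul]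
  · intro h
    exact Subtype.ext h

lemma sl_comm (h x y : Matrix.SpecialLinearGroup (Fin 2) F) (hh : (h : Matrix (Fin 2) (Fin 2) F).trace ^ 2 ≠ 4)
    (hx : h * x = x * h) (hy : h * y = y * h) : x * y = y * x := by
  rw [sl_comm_iff] at hx hy ⊢
  obtain ⟨α, β, hα⟩ := lin_of_comm _ _ hh h.2 hx
  rw [hα, add_mul, mul_add, smul_mul_assoc, smul_mul_assoc, mul_smul_comm, mul_smul_comm, hy,
    one_mul, mul_one]

lemma sl_inv_coe (h : Matrix.SpecialLinearGroup (Fin 2) F) : ((h⁻¹ : Matrix.SpecialLinearGroup (Fin 2) F) : Matrix (Fin 2) (Fin 2) F) =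
    (h : Matrix (Fin 2) (Fin 2) F).trace • 1 - (h : Matrix (Fin 2) (Fin 2) F) := by
  rw [Matrix.SpecialLinearGroup.coe_inv, Matrix.adjugate_fin_two, Matrix.trace_fin_two]
  ext i j
  fin_cases i <;> fin_cases j <;> simp

lemma sl_conj (h x y : Matrix.SpecialLinearGroup (Fin 2) F) (hh : (h : Matrix (Fin 2) (Fin 2) F).trace ^ 2 ≠ 4)
    (hx : h * x = x * h) (hy : y⁻¹ * h * y = x) : x = h ∨ x = h⁻¹ := by
  have ht : (x : Matrix (Fin 2) (Fin 2) F).trace = (h : Matrix (Fin 2) (Fin 2) F).trace := by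
    rw [← hy, mul_assoc, Matrix.SpecialLinearGroup.coe_mul, Matrix.trace_mul_comm,
      ← Matrix.SpecialLinearGroup.coe_mul, mul_assoc, mul_inv_cancel, mul_one]
  rw [sl_comm_iff] at hx
  rcases eq_or_eq_inv _ _ hh h.2 x.2 ht hx with h1 | h1
  · left; exact Subtype.ext h1
  · right
    apply Subtype.ext
    rw [sl_inv_coe]; exact h1

lemma sl_exists_w [Fintype F] (h : Matrix.SpecialLinearGroup (Fin 2) F) (hh : (h : Matrix (Fin 2) (Fin 2) F).trace ^ 2 ≠ 4) :
    ∃ w : Matrix.SpecialLinearGroup (Fin 2) F, ∀ t : Matrix.SpecialLinearGroup (Fin 2) F, h * t = t * h → w * t * w⁻¹ = t⁻¹ := by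
  obtain ⟨x, y, u, h1, h2⟩ := exists_w _ hh h.2
  obtain ⟨w, hw⟩ : ∃ w : Matrix.SpecialLinearGroup (Fin 2) F, (w : Matrix (Fin 2) (Fin 2) F) = !![x, y; u, -x] :=
    ⟨⟨!![x, y; u, -x], by rw [Matrix.det_fin_two_of]; linear_combination -h1⟩, rfl⟩
  refine ⟨w, ?_⟩
  intro t ht
  rw [sl_comm_iff] at ht
  obtain ⟨α, β, hα⟩ := lin_of_comm _ _ hh h.2 ht
  rw [mul_inv_eq_iff_eq_mul]
  apply Subtype.ext
  rw [Matrix.SpecialLinearGroup.coe_mul, Matrix.SpecialLinearGroup.coe_mul, sl_inv_coe, hα, hw,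
    Matrix.trace_fin_two]
  ext i j
  fin_cases i <;> fin_cases j <;> simp [Matrix.mul_apply, Fin.sum_univ_two]
  · linear_combination β * h2
  · ring
  · ring
  · linear_combination β * h2

lemma sl_card [Fintype F] (h w g : Matrix.SpecialLinearGroup (Fin 2) F) (hh : (h : Matrix (Fin 2) (Fin 2) F).trace ^ 2 ≠ 4)
    (hw : ∀ t : Matrix.SpecialLinearGroup (Fin 2) F, h * t = t * h → w * t * w⁻¹ = t⁻¹)
    (hg : (g : Matrix (Fin 2) (Fin 2) F).trace ^ 2 ≠ 4) :
    Nat.card {y : Matrix.SpecialLinearGroup (Fin 2) F // y⁻¹ * g * y ∈ Subgroup.centralizer {h}} ≤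
      2 * Nat.card (Subgroup.centralizer {h}) := by
  apply card_le_aux _ g w
  intro y hy z hz
  rw [Subgroup.mem_centralizer_singleton_iff] at hy hz
  rw [Subgroup.mem_centralizer_singleton_iff, Subgroup.mem_centralizer_singleton_iff]
  set t := y⁻¹ * g * y with ht
  have htt : (t : Matrix (Fin 2) (Fin 2) F).trace ^ 2 ≠ 4 := by
    rw [ht, mul_assoc, Matrix.SpecialLinearGroup.coe_mul, Matrix.trace_mul_comm,
      ← Matrix.SpecialLinearGroup.coe_mul, mul_assoc, mul_inv_cancel, mul_one]
    exact hg
  have hzt : (y * z)⁻¹ * g * (y * z) = z⁻¹ * t * z := by rw [ht]; group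
  rw [hzt] at hz
  have hc : t * (z⁻¹ * t * z) = z⁻¹ * t * z * t := sl_comm h _ _ hh (by rw [hy]) (by rw [hz])
  rcases sl_conj t _ z htt hc rfl with h1 | h1
  · left
    have h2 : t * z = z * t := by
      rw [mul_assoc, inv_mul_eq_iff_eq_mul] at h1; exact h1
    exact sl_comm t _ _ htt h2 hy
  · right
    rw [← hw t (by rw [hy])] at h1
    have h2 : t * (z * w) = z * w * t := by
      rw [mul_assoc, inv_mul_eq_iff_eq_mul, eq_comm] at h1
      rw [← mul_assoc, ← h1]; group
    exact sl_comm t _ _ htt h2 hy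

lemma sl_regular (p n m r : ℕ) (hp : p.Prime) (hp2 : p ≠ 2) (hr : r.Prime) [CharP F r]
    (hpr : p ≠ r) (g : Matrix.SpecialLinearGroup (Fin 2) F) (hN : g ^ (p ^ n * m) = 1) (hm : g ^ m ≠ 1) :
    (g : Matrix (Fin 2) (Fin 2) F).trace ^ 2 ≠ 4 := by
  intro h
  apply hm
  have h1 : g ^ (2 * r) = 1 := by
    apply Subtype.ext
    rw [Matrix.SpecialLinearGroup.coe_pow]
    exact pow_two_char r hr _ h g.2
  have h2 : (orderOf g).Coprime (p ^ n) := by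
    apply Nat.Coprime.pow_right
    apply Nat.Coprime.coprime_dvd_left (orderOf_dvd_of_pow_eq_one h1)
    apply Nat.Coprime.mul_left
    · exact ((Nat.coprime_primes Nat.prime_two hp).2 (Ne.symm hp2))
    · exact ((Nat.coprime_primes hr hp).2 (Ne.symm hpr))
  exact orderOf_dvd_iff_pow_eq_one.1 (h2.dvd_of_dvd_mul_left (orderOf_dvd_of_pow_eq_one hN))

lemma sl_char_p (p n m : ℕ) (hp : p.Prime) (hp2 : p ≠ 2) [CharP F p]
    (g : Matrix.SpecialLinearGroup (Fin 2) F) (hN : g ^ (p ^ n * m) = 1) : g ^ (m * p) = 1 := by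
  have : Fact p.Prime := ⟨hp⟩
  set u := g ^ m with hu
  have h1 : u ^ (p ^ n) = 1 := by rw [hu, ← pow_mul, mul_comm, hN]
  have h2 : ((u : Matrix (Fin 2) (Fin 2) F) - 1) ^ (p ^ n) = 0 := by
    rw [sub_pow_char_pow_of_commute _ _ (Commute.one_right _), one_pow,
      ← Matrix.SpecialLinearGroup.coe_pow, h1, Matrix.SpecialLinearGroup.coe_one, sub_self]
  have h3 : ((u : Matrix (Fin 2) (Fin 2) F) - 1).det = 0 := by
    have h4 := congrArg Matrix.det h2
    rw [Matrix.det_pow, Matrix.det_zero] at h4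
    exact pow_eq_zero_iff (pow_ne_zero n hp.ne_zero) |>.1 h4
  have hd := u.2
  have h5 : (u : Matrix (Fin 2) (Fin 2) F).trace ^ 2 = 4 := by
    rw [Matrix.det_fin_two] at h3 hd
    rw [Matrix.trace_fin_two]
    simp at h3
    have h6 : u 0 0 + u 1 1 = 2 := by linear_combination hd - h3
    have h7 : (u : Matrix (Fin 2) (Fin 2) F) 0 0 + (u : Matrix (Fin 2) (Fin 2) F) 1 1 = 2 := h6
    rw [h7]; norm_num
  have h6 : u ^ (2 * p) = 1 := by
    apply Subtype.ext
    rw [Matrix.SpecialLinearGroup.coe_pow]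
    exact pow_two_char p hp _ h5 u.2
  rw [pow_mul, ← hu]
  have h7 : (orderOf u).Coprime 2 := by
    apply Nat.Coprime.coprime_dvd_left (orderOf_dvd_of_pow_eq_one h1)
    apply Nat.Coprime.pow_left
    exact (Nat.coprime_primes hp Nat.prime_two).2 hp2
  exact orderOf_dvd_iff_pow_eq_one.1 (h7.dvd_of_dvd_mul_left (orderOf_dvd_of_pow_eq_one h6))

end SL2G

theorem main_aux (F : Type) [Field F] [Fintype F] [DecidableEq F]
    (p : ℕ) (hp : p.Prime) (hp2 : p ≠ 2) {W : Type*} [AddCommGroup W] [Module ℂ W]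
    [FiniteDimensional ℂ W] (ρ : Representation ℂ (Matrix.SpecialLinearGroup (Fin 2) F) W)
    (hirr : (Nat.card (Matrix.SpecialLinearGroup (Fin 2) F) : ℂ)⁻¹ *
      ∑ g : Matrix.SpecialLinearGroup (Fin 2) F, ρ.character g * ρ.character g⁻¹ = 1) :
    Property13 ρ.character p := by
  classical
  intro f hf
  obtain ⟨⟨hf0, hfχ⟩, hfmin⟩ := hf
  by_cases ha1 : f.factorization p ≤ 1
  · exact ⟨1, ⟨0, by simp⟩, relfinrank_small hp ha1 _⟩
  by_contra hcon
  push Not at hcon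
  set a := f.factorization p with ha
  have ha2 : 2 ≤ a := by omega
  have hN0 : 0 < Nat.card (Matrix.SpecialLinearGroup (Fin 2) F) * f := Nat.mul_pos Nat.card_pos hf0
  obtain ⟨n, m, hpm', hNm⟩ := Nat.exists_eq_pow_mul_and_not_dvd hN0.ne' p hp.ne_one
  have hpm : p.Coprime m := (Nat.Prime.coprime_iff_not_dvd hp).2 hpm'
  have hm : 0 < m := Nat.pos_of_ne_zero (by rintro rfl; simp at hpm')
  have hN : ∀ g : Matrix.SpecialLinearGroup (Fin 2) F, g ^ (p ^ n * m) = 1 := by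
    intro g
    rw [← hNm, pow_mul, pow_card_eq_one', one_pow]
  have hpa : p ^ a ∣ f := Nat.ordProj_dvd f p
  have han : a ≤ n := by
    have h1 : p ^ a ∣ p ^ n * m := by rw [← hNm]; exact hpa.mul_left _
    have h2 : p ^ a ∣ p ^ n := (Nat.Coprime.pow_left a hpm).dvd_of_dvd_mul_right h1
    exact (Nat.pow_dvd_pow_iff_le_right hp.one_lt).1 h2
  have hA : ∀ g : Matrix.SpecialLinearGroup (Fin 2) F, g ^ (p ^ n) = 1 →
      ρ.character g ∈ Qcyc (p ^ (a - 1)) := by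
    intro g hg
    obtain ⟨j, -, hj⟩ := (Nat.dvd_prime_pow hp).1 (orderOf_dvd_of_pow_eq_one hg)
    have h1 := hcon g ⟨j, hj⟩
    have h2 : ρ.character g ∈ Qcyc (p ^ a) := by
      have h3 := Qcyc_inf_s8 (pow_pos hp.pos n) hf0 (char_mem_Qcyc ρ g _ hg) (hfχ g)
      obtain ⟨i, -, hi⟩ := (Nat.dvd_prime_pow hp).1 (Nat.gcd_dvd_left (p ^ n) f)
      have h4 : p ^ i ∣ f := hi ▸ Nat.gcd_dvd_right (p ^ n) f
      have h5 : i ≤ a := (hp.pow_dvd_iff_le_factorization hf0.ne').1 h4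
      rw [hi] at h3
      exact Qcyc_mono_s8 (pow_dvd_pow p h5) h3
    have h6 : Qadj (ρ.character g) ≤ Qcyc (p ^ a) := by
      unfold Qadj
      rw [IntermediateField.adjoin_simple_le_iff]
      exact h2
    exact p_div_le hp hp2 ha2 _ h6 h1 (IntermediateField.mem_adjoin_simple_self ℚ _)
  set d := m * p ^ (a - 1) with hd
  have hd0 : 0 < d := Nat.mul_pos hm (pow_pos hp.pos _)
  have hdN : d ∣ p ^ n * m := by
    rw [hd, mul_comm]
    exact Nat.mul_dvd_mul_right (pow_dvd_pow p (by omega)) m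
  obtain ⟨h, hh⟩ : ∃ h, ρ.character h ∉ Qcyc d := by
    by_contra hall
    push Not at hall
    have h1 : f ≤ f.gcd d := hfmin ⟨Nat.gcd_pos_of_pos_left _ hf0,
      fun g => Qcyc_inf_s8 hf0 hd0 (hfχ g) (hall g)⟩
    have h2 : f.gcd d = f := le_antisymm (Nat.le_of_dvd hf0 (Nat.gcd_dvd_left _ _)) h1
    have h3 : p ^ a ∣ m * p ^ (a - 1) := hpa.trans (h2 ▸ Nat.gcd_dvd_right f d)
    have h4 : p ^ a ∣ p ^ (a - 1) := (Nat.Coprime.pow_left a hpm).dvd_of_dvd_mul_left h3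
    have := (Nat.pow_dvd_pow_iff_le_right hp.one_lt).1 h4
    omega
  have hNpos : 0 < p ^ n * m := hNm ▸ hN0
  obtain ⟨σ, hσd, hσh⟩ := endo_fixed hNpos hdN _ (char_mem_Qcyc ρ h _ (hN h)) hh
  obtain ⟨s, hsN, hσ⟩ := endo_pow (p ^ n * m) hNpos σ
  have hsd : s ≡ 1 [MOD d] := by
    apply modEq_of_fix d hd0
    intro z hz
    have h1 : z ^ (p ^ n * m) = 1 := by
      obtain ⟨k, hk⟩ := hdN
      rw [hk, pow_mul, hz, one_pow]
    rw [← hσ z h1]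
    exact hσd z (root_mem_Qcyc hz)
  have hsm : s ≡ 1 [MOD m] := hsd.of_dvd (Dvd.intro _ rfl)
  have hpd : p ∣ p ^ (a - 1) := dvd_pow_self p (by omega)
  have hsp : s ≡ 1 [MOD p] := hsd.of_dvd (hpd.mul_left m)
  have hψm : ∀ g : Matrix.SpecialLinearGroup (Fin 2) F, g ^ m = 1 →
      σ (ρ.character g) = ρ.character g := fun g hg =>
    hσd _ (Qcyc_mono_s8 (Dvd.intro _ rfl) (char_mem_Qcyc ρ g m hg))
  obtain ⟨r, hr⟩ := CharP.exists F
  have hrp : r.Prime := (CharP.char_is_prime_or_zero F r).resolve_right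
    (CharP.char_ne_zero_of_finite F r)
  by_cases hpr : p = r
  · subst hpr
    have h1 := sl_char_p p n m hp hp2 h (hN h)
    exact hh (Qcyc_mono_s8 (Nat.mul_dvd_mul_left m hpd) (char_mem_Qcyc ρ h _ h1))
  · have hreg : ∀ g : Matrix.SpecialLinearGroup (Fin 2) F, σ (ρ.character g) ≠ ρ.character g →
        (g : Matrix (Fin 2) (Fin 2) F).trace ^ 2 ≠ 4 := fun g hg =>
      sl_regular p n m r hp hp2 hrp hpr g (hN g) (fun h1 => hg (hψm g h1))
    have hhr := hreg h hσh
    obtain ⟨w, hw⟩ := sl_exists_w h hhr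
    let T : Subgroup (Matrix.SpecialLinearGroup (Fin 2) F) := Subgroup.centralizer {h}
    have hmem : ∀ x, x ∈ T ↔ h * x = x * h := by
      intro x
      rw [Subgroup.mem_centralizer_singleton_iff]
      exact eq_comm
    let _ : CommGroup T := { (inferInstance : Group T) with
      mul_comm := by
        rintro ⟨x, hx⟩ ⟨y, hy⟩
        exact Subtype.ext (sl_comm h x y hhr ((hmem x).1 hx) ((hmem y).1 hy)) }
    have key := thmR ρ hirr T.subtype T.subtype_injective σ p n m s hp hp2 hm hpm hN hsN hsm hsp hσ
      w (fun t => hw t ((hmem t).1 t.2))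
      (fun g hg => hσd _ (Qcyc_mono_s8 (Dvd.intro_left _ rfl) (hA g hg)))
      (fun g hg => by
        have h1 := sl_card h w g hhr hw (hreg g (fun h2 => hg (by rw [h2, sub_self])))
        rw [Subgroup.range_subtype]
        exact h1)
    exact hσh (key ⟨h, (hmem h).2 rfl⟩)

/-- Property 1.3 holds for `SL₂(F_q)` (`q ≥ 4` a prime power), every odd prime
`p` and every irreducible character of degree not divisible by `p`. -/
theorem stmt8 (F : Type) [Field F] [Fintype F] [DecidableEq F]
    (q : ℕ) (hq : Fintype.card F = q) (hq4 : 4 ≤ q)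
    (p : ℕ) (hp : p.Prime) (hodd : Odd p)
    (V : FDRep ℂ (Matrix.SpecialLinearGroup (Fin 2) F)) (hV : Simple V)
    (hdeg : ¬ p ∣ Module.finrank ℂ V) :
    Property13 V.character p := by
  have hp2 : p ≠ 2 := by rintro rfl; exact absurd hodd (by decide)
  have h3 : (Nat.card (Matrix.SpecialLinearGroup (Fin 2) F) : ℂ) ≠ 0 := by simp
  have : Invertible (Nat.card (Matrix.SpecialLinearGroup (Fin 2) F) : ℂ) := invertibleOfNonzero h3
  refine main_aux F p hp hp2 V.ρ ?_
  have h1 := FDRep.char_orthonormal V V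
  rw [if_pos ⟨Iso.refl V⟩] at h1
  exact h1
end
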